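/- arXiv:1806.00477 — 5 statements merged into one kernel-verified Lean document; each statement's English description precedes it below -/
import Mathlib

section
/- Let 0 < σ < 1, let a < b be reals, let u : [a,b] → ℝ be continuously differentiable, and let x ∈ (a,b]. Assume the derivative defining the left-sided RL-type Log-Pow operator at x exists. Then (1/Γ(1−σ)) · d/dx ∫_a^x log(x−s)·(x−s)^{−σ}·u(s) ds = u(a)·log(x−a) / (Γ(1−σ)·(x−a)^σ) + (1/Γ(1−σ)) · ∫_a^x log(x−s)·(x−s)^{−σ}·u′(s) ds; that is, the left-sided Riemann–Liouville-type Log-Pow integro-differential operator of order σ applied to u equals the boundary term u(a)·log(x−a)/(Γ(1−σ)(x−a)^σ) plus the Caputo-type Log-Pow operator applied to u. -/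
open MeasureTheory Set Filter Topology

/-- The kernel `log t * t ^ (-σ)` is integrable near `0` when `σ < 1`. -/
theorem intervalIntegrable_log_mul_rpow_neg {σ c : ℝ} (hσ : σ < 1) (hc : 0 ≤ c) :
    IntervalIntegrable (fun t : ℝ => Real.log t * t ^ (-σ)) volume 0 c := by
  have hmeas : Measurable (fun t : ℝ => Real.log t * t ^ (-σ)) := by fun_prop
  have h01 : IntervalIntegrable (fun t : ℝ => Real.log t * t ^ (-σ)) volume 0 1 := by
    have hε : 0 < (1 - σ) / 2 := by linarith
    have hg : IntervalIntegrable (fun t : ℝ => 1 / ((1 - σ) / 2) * t ^ (-σ - (1 - σ) / 2))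
        volume 0 1 :=
      (intervalIntegral.intervalIntegrable_rpow' (by linarith)).const_mul _
    refine hg.mono_fun' hmeas.aestronglyMeasurable ?_
    refine (ae_restrict_iff' measurableSet_uIoc).2 (Eventually.of_forall fun t ht => ?_)
    rw [uIoc_of_le zero_le_one] at ht
    have hsplit : t ^ (-σ) = t ^ ((1 - σ) / 2) * t ^ (-σ - (1 - σ) / 2) := by
      rw [← Real.rpow_add ht.1]
      ring_nf
    have hpos : 0 < t ^ (-σ - (1 - σ) / 2) := Real.rpow_pos_of_pos ht.1 _
    beta_reduce
    rw [hsplit, ← mul_assoc, Real.norm_eq_abs, abs_mul, abs_of_pos hpos]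
    exact mul_le_mul_of_nonneg_right (Real.abs_log_mul_self_rpow_lt t _ ht.1 ht.2 hε).le hpos.le
  rcases hc.eq_or_lt with rfl | hc
  · exact IntervalIntegrable.refl
  refine h01.trans (ContinuousOn.intervalIntegrable fun t ht => ?_)
  have ht0 : t ≠ 0 := ((lt_min one_pos hc).trans_le ht.1).ne'
  exact ((Real.continuousAt_log ht0).mul
    (Real.continuousAt_rpow_const t _ (Or.inl ht0))).continuousWithinAt

/-- One-sided Leibniz rule for the Volterra convolution of a locally integrable kernel with a
continuously differentiable function. -/
theorem hasDerivWithinAt_integral_volterra {k u : ℝ → ℝ} {a b x : ℝ} (hk : Measurable k)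
    (hint : ∀ c, 0 ≤ c → IntervalIntegrable k volume 0 c) (hx : x ∈ Ioc a b)
    (hc : ContinuousAt k (x - a)) (hu : ContDiffOn ℝ 1 u (Icc a b)) :
    HasDerivWithinAt (fun y => ∫ s in a..y, k (y - s) * u s)
      (u a * k (x - a) + ∫ s in a..x, k (x - s) * derivWithin u (Icc a b) s) (Icc a x) x := by
  have hab : a ≤ b := hx.1.le.trans hx.2
  obtain ⟨K, hK⟩ := hu.exists_lipschitzOnWith one_ne_zero (convex_Icc a b) isCompact_Icc
  obtain ⟨w, hw_lip, hw_eq, hw_zero⟩ : ∃ w : ℝ → ℝ, LipschitzWith K w ∧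
      (∀ s ∈ Icc a b, u s = u a + w s) ∧ ∀ s ≤ a, w s = 0 := by
    refine ⟨fun s => u (projIcc a b hab s) - u a, ?_, fun s hs => ?_, fun s hs => ?_⟩
    · refine LipschitzWith.of_dist_le_mul fun y z => ?_
      rw [dist_sub_right]
      refine (hK.dist_le_mul _ (projIcc a b hab y).2 _ (projIcc a b hab z).2).trans ?_
      have h := (LipschitzWith.projIcc hab).dist_le_mul y z
      rw [NNReal.coe_one, one_mul] at h
      exact mul_le_mul_of_nonneg_left h K.2
    · simp [projIcc_of_mem hab hs]
    · simp [projIcc_of_le_left hab hs]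
  have hw_deriv : ∀ s ∈ Ioo a b, HasDerivAt w (derivWithin u (Icc a b) s) s := fun s hs => by
    have hnhds : Icc a b ∈ 𝓝 s := Icc_mem_nhds hs.1 hs.2
    have h : HasDerivAt u (derivWithin u (Icc a b) s) s :=
      ((hu.differentiableOn one_ne_zero s (Ioo_subset_Icc_self hs)).hasDerivWithinAt).hasDerivAt
        hnhds
    refine (h.sub_const (u a)).congr_of_eventuallyEq ?_
    filter_upwards [hnhds] with t ht
    rw [hw_eq t ht]
    ring
  have hxa : 0 ≤ x - a := sub_nonneg.2 hx.1.le
  have hkw : ∀ y c, 0 ≤ c → IntervalIntegrable (fun t => k t * w (y - t)) volume 0 c :=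
    fun y c h => (hint c h).mul_continuousOn
      (hw_lip.continuous.comp (continuous_const.sub continuous_id)).continuousOn
  have hconst : HasDerivAt (fun y => ∫ t in (0 : ℝ)..(y - a), k t) (k (x - a)) x := by
    have h := intervalIntegral.integral_hasDerivAt_right (hint _ hxa)
      hk.stronglyMeasurable.stronglyMeasurableAtFilter hc
    simpa using h.comp_sub_const x a
  have hconv := (intervalIntegral.hasDerivAt_integral_of_dominated_loc_of_lip
    (μ := volume) (a := 0) (b := x - a) (x₀ := x) (s := univ)
    (F := fun y t => k t * w (y - t)) (F' := fun t => k t * deriv w (x - t))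
    (bound := fun t => |k t| * K) univ_mem
    (Eventually.of_forall fun y => (hk.mul (hw_lip.continuous.measurable.comp
      (measurable_const.sub measurable_id))).aestronglyMeasurable)
    (hkw x _ hxa)
    (hk.mul ((measurable_deriv w).comp
      (measurable_const.sub measurable_id))).aestronglyMeasurable
    (Eventually.of_forall fun t _ => by
      refine LipschitzOnWith.of_dist_le_mul fun y _ z _ => ?_
      have h := hw_lip.dist_le_mul (y - t) (z - t)
      rw [dist_sub_right] at h
      rw [Real.dist_eq, ← mul_sub, abs_mul, ← Real.dist_eq]
      have hb : ((Real.nnabs (|k t| * K) : NNReal) : ℝ) = |k t| * K := by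
        simp
      rw [hb, mul_assoc]
      exact mul_le_mul_of_nonneg_left h (abs_nonneg _))
    ((hint _ hxa).abs.mul_const _)
    (by
      filter_upwards [Measure.ae_ne volume (x - a)] with t hne ht
      rw [uIoc_of_le hxa] at ht
      have hmem : x - t ∈ Ioo a b :=
        ⟨by linarith [lt_of_le_of_ne ht.2 hne], by linarith [ht.1, hx.2]⟩
      exact ((hw_deriv _ hmem).differentiableAt.hasDerivAt.comp_sub_const x t).const_mul _)).2
  have hderiv : ∫ t in (0 : ℝ)..(x - a), k t * deriv w (x - t)
      = ∫ s in a..x, k (x - s) * derivWithin u (Icc a b) s := by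
    have h := intervalIntegral.integral_comp_sub_left (a := a) (b := x)
      (fun t => k t * deriv w (x - t)) x
    simp only [sub_self, sub_sub_cancel] at h
    rw [← h]
    refine intervalIntegral.integral_congr_ae ?_
    filter_upwards [Measure.ae_ne volume x] with s hne hs
    rw [uIoc_of_le hx.1.le] at hs
    rw [(hw_deriv s ⟨hs.1, (lt_of_le_of_ne hs.2 hne).trans_le hx.2⟩).deriv]
  have hsplit : ∀ y ∈ Icc a x, ∫ s in a..y, k (y - s) * u s
      = u a * (∫ t in (0 : ℝ)..(y - a), k t) + ∫ t in (0 : ℝ)..(x - a), k t * w (y - t) := by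
    intro y hy
    have hya : 0 ≤ y - a := sub_nonneg.2 hy.1
    have h := intervalIntegral.integral_comp_sub_left (a := a) (b := y)
      (fun t => u a * k t + k t * w (y - t)) y
    simp only [sub_self, sub_sub_cancel] at h
    have htail : ∫ t in (y - a)..(x - a), k t * w (y - t) = 0 := by
      refine intervalIntegral.integral_zero_ae (Eventually.of_forall fun t ht => ?_)
      rw [uIoc_of_le (by linarith [hy.2])] at ht
      rw [hw_zero _ (by linarith [ht.1]), mul_zero]
    rw [← intervalIntegral.integral_add_adjacent_intervals (hkw y _ hya)
      ((hkw y _ hya).symm.trans (hkw y _ hxa)), htail, add_zero,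
      ← intervalIntegral.integral_const_mul, ← intervalIntegral.integral_add
        ((hint _ hya).const_mul _) (hkw y _ hya), ← h]
    refine intervalIntegral.integral_congr fun s hs => ?_
    rw [uIcc_of_le hy.1] at hs
    simp only [hw_eq s ⟨hs.1, hs.2.trans (hy.2.trans hx.2)⟩]
    ring
  rw [← hderiv]
  exact ((hconst.const_mul (u a)).add hconv).hasDerivWithinAt.congr hsplit
    (hsplit x (right_mem_Icc.2 hx.1.le))

/-- Lemma 2.1, Part A of the paper.
For `0 < σ < 1`, `u` continuously differentiable on `[a,b]`, and `x ∈ (a,b]`, if the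
derivative defining the left-sided Riemann–Liouville-type Log-Pow operator of order `σ`
exists at `x` (with value `D`), then
`(1/Γ(1-σ)) D = u(a) log(x-a)/(Γ(1-σ)(x-a)^σ) + (1/Γ(1-σ)) ∫_a^x log(x-s)(x-s)^{-σ} u'(s) ds`. -/
theorem stmt0 (σ a b : ℝ) (hσ0 : 0 < σ) (hσ1 : σ < 1) (hab : a < b)
    (u : ℝ → ℝ) (hu : ContDiffOn ℝ 1 u (Set.Icc a b))
    (x : ℝ) (hx : x ∈ Set.Ioc a b)
    (D : ℝ)
    (hD : HasDerivAt (fun y => ∫ s in a..y, Real.log (y - s) * (y - s) ^ (-σ) * u s) D x) :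
    (1 / Real.Gamma (1 - σ)) * D
      = u a * Real.log (x - a) / (Real.Gamma (1 - σ) * (x - a) ^ σ)
        + (1 / Real.Gamma (1 - σ)) *
            ∫ s in a..x, Real.log (x - s) * (x - s) ^ (-σ) * derivWithin u (Set.Icc a b) s := by
  have hpos : 0 < x - a := sub_pos.2 hx.1
  have hderiv := hasDerivWithinAt_integral_volterra
    (k := fun t => Real.log t * t ^ (-σ)) (by fun_prop)
    (fun _ => intervalIntegrable_log_mul_rpow_neg hσ1) hx
    ((Real.continuousAt_log hpos.ne').mul
      (Real.continuousAt_rpow_const _ _ (Or.inl hpos.ne'))) hu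
  rw [(uniqueDiffOn_Icc hx.1 x (right_mem_Icc.2 hx.1.le)).eq_deriv _ hD.hasDerivWithinAt hderiv,
    Real.rpow_neg hpos.le]
  have hΓ : Real.Gamma (1 - σ) ≠ 0 := (Real.Gamma_pos_of_pos (by linarith)).ne'
  have hpow : (x - a) ^ σ ≠ 0 := (Real.rpow_pos_of_pos hpos σ).ne'
  field_simp
end

section
/- Let 1 < σ < 2, let a < b be reals, let u : [a,b] → ℝ be twice continuously differentiable, and let x ∈ (a,b]. Assume the second derivative defining the left-sided RL-type Log-Pow operator at x exists. Then (1/Γ(2−σ)) · d²/dx² ∫_a^x log(x−s)·(x−s)^{1−σ}·u(s) ds = u(a)·(1 + (1−σ)·log(x−a)) / (Γ(2−σ)·(x−a)^σ) + u′(a)·log(x−a) / (Γ(2−σ)·(x−a)^{σ−1}) + (1/Γ(2−σ)) · ∫_a^x log(x−s)·(x−s)^{1−σ}·u″(s) ds. -/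
open MeasureTheory Set Filter Topology

theorem intervalIntegrable_log_mul_rpow {r : ℝ} (hr : -1 < r) {T : ℝ} (hT : 0 ≤ T) :
    IntervalIntegrable (fun t : ℝ => Real.log t * t ^ r) volume 0 T := by
  obtain ⟨ε, hε, hrε⟩ : ∃ ε : ℝ, 0 < ε ∧ -1 < r - ε := ⟨(r + 1) / 2, by linarith, by linarith⟩
  have hdom : IntervalIntegrable (fun t : ℝ => (t ^ (r + ε) + t ^ (r - ε)) / ε) volume 0 T :=
    ((intervalIntegral.intervalIntegrable_rpow' (by linarith)).add
      (intervalIntegral.intervalIntegrable_rpow' hrε)).div_const ε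
  refine hdom.mono_fun' (by fun_prop) ?_
  rw [uIoc_of_le hT]
  refine (ae_restrict_iff' measurableSet_Ioc).2 (.of_forall fun t ht => ?_)
  have ht0 : 0 < t := ht.1
  have h1 : Real.log t ≤ t ^ ε / ε := Real.log_le_rpow_div ht0.le hε
  have h2 : -Real.log t ≤ t ^ (-ε) / ε := by
    have h := Real.log_le_rpow_div (inv_nonneg.2 ht0.le) hε
    rwa [Real.log_inv, Real.inv_rpow ht0.le, ← Real.rpow_neg ht0.le] at h
  have hlog : |Real.log t| ≤ (t ^ ε + t ^ (-ε)) / ε := by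
    rw [add_div]
    have h3 : 0 ≤ t ^ ε / ε := by positivity
    have h4 : 0 ≤ t ^ (-ε) / ε := by positivity
    exact abs_le.2 ⟨by linarith, by linarith⟩
  calc ‖Real.log t * t ^ r‖ = |Real.log t| * t ^ r := by
        rw [norm_mul, Real.norm_eq_abs, Real.norm_of_nonneg (by positivity)]
    _ ≤ (t ^ ε + t ^ (-ε)) / ε * t ^ r := by gcongr
    _ = (t ^ (r + ε) + t ^ (r - ε)) / ε := by
        rw [sub_eq_add_neg, Real.rpow_add ht0, Real.rpow_add ht0]
        ring

/-- Differentiation of a truncated convolution whose kernel may be singular at the origin. -/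
theorem hasDerivAt_integral_kernel_sub_mul {k v v' : ℝ → ℝ} {a x : ℝ}
    (hk : ∀ T, 0 ≤ T → IntervalIntegrable k volume 0 T) (hkc : ContinuousOn k (Ioi 0))
    (hv : ∀ s, HasDerivAt v (v' s) s) (hv' : Continuous v') (hax : a < x) :
    HasDerivAt (fun y => ∫ s in a..y, k (y - s) * v s)
      (k (x - a) * v a + ∫ s in a..x, k (x - s) * v' s) x := by
  have hvc : Continuous v := continuous_iff_continuousAt.2 fun s => (hv s).continuousAt
  set T : ℝ := x - a + 1 with hT
  have hT0 : 0 ≤ T := by linarith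
  have hkmeas : AEStronglyMeasurable k (volume.restrict (uIoc 0 T)) :=
    (intervalIntegrable_iff.1 (hk T hT0)).aestronglyMeasurable
  let w : ℝ → ℝ := fun s => v (max s a) - v a
  have hwc : Continuous w := by fun_prop
  obtain ⟨C, hC⟩ : ∃ C : NNReal, LipschitzOnWith C v (Icc a (x + 1)) := by
    obtain ⟨C, hC⟩ := isCompact_Icc.exists_bound_of_continuousOn (s := Icc a (x + 1))
      hv'.continuousOn
    refine ⟨C.toNNReal, (convex_Icc a (x + 1)).lipschitzOnWith_of_nnnorm_hasDerivWithin_le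
      (fun s _ => (hv s).hasDerivWithinAt) fun s hs => ?_⟩
    rw [← NNReal.coe_le_coe, coe_nnnorm]
    exact (hC s hs).trans (Real.le_coe_toNNReal C)
  have hsplit : ∀ y ∈ Ioo a (x + 1), (∫ s in a..y, k (y - s) * v s)
      = v a * (∫ t in (0 : ℝ)..(y - a), k t) + ∫ t in (0 : ℝ)..T, k t * w (y - t) := by
    intro y hy
    have hy0 : 0 ≤ y - a := by linarith [hy.1]
    have hyT : y - a ≤ T := by linarith [hy.2]
    have hkw : IntervalIntegrable (fun t => k t * w (y - t)) volume 0 T :=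
      (hk T hT0).mul_continuousOn (by fun_prop)
    have hsub1 : uIcc 0 (y - a) ⊆ uIcc 0 T :=
      uIcc_subset_uIcc_left (by rw [uIcc_of_le hT0]; exact ⟨hy0, hyT⟩)
    have hsub2 : uIcc (y - a) T ⊆ uIcc 0 T :=
      uIcc_subset_uIcc_right (by rw [uIcc_of_le hT0]; exact ⟨hy0, hyT⟩)
    have hzero : ∫ t in (y - a)..T, k t * w (y - t) = 0 := by
      rw [← intervalIntegral.integral_zero (a := y - a) (b := T) (μ := volume)]
      refine intervalIntegral.integral_congr fun t ht => ?_
      rw [uIcc_of_le hyT] at ht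
      simp [w, max_eq_right (show y - t ≤ a by linarith [ht.1])]
    rw [← intervalIntegral.integral_add_adjacent_intervals (hkw.mono_set hsub1)
      (hkw.mono_set hsub2), hzero, add_zero, ← intervalIntegral.integral_const_mul,
      ← intervalIntegral.integral_add ((hk _ hy0).const_mul _) (hkw.mono_set hsub1)]
    have hcv := intervalIntegral.integral_comp_sub_left (a := a) (b := y)
      (fun t => k t * v (y - t)) y
    simp only [sub_sub_cancel, sub_self] at hcv
    rw [hcv]
    refine intervalIntegral.integral_congr fun t ht => ?_
    rw [uIcc_of_le hy0] at ht
    simp only [w, max_eq_left (show a ≤ y - t by linarith [ht.2])]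
    ring
  have hnhds : Ioo a (x + 1) ∈ 𝓝 x := Ioo_mem_nhds hax (by linarith)
  have hxa0 : 0 < x - a := by linarith
  have hder1 : HasDerivAt (fun y => v a * ∫ t in (0 : ℝ)..(y - a), k t) (v a * k (x - a)) x := by
    have h := intervalIntegral.integral_hasDerivAt_right (hk (x - a) hxa0.le)
      (hkc.stronglyMeasurableAtFilter isOpen_Ioi _ hxa0) (hkc.continuousAt (Ioi_mem_nhds hxa0))
    exact ((HasDerivAt.comp_sub_const x a h)).const_mul (v a)
  have hder2 := (intervalIntegral.hasDerivAt_integral_of_dominated_loc_of_lip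
    (μ := volume) (a := 0) (b := T) (F := fun y t => k t * w (y - t))
    (F' := fun t => k t * (Iio (x - a)).indicator (fun t => v' (x - t)) t)
    (bound := fun t => C * k t) hnhds
    (.of_forall fun y => hkmeas.mul (by fun_prop))
    ((hk T hT0).mul_continuousOn (by fun_prop))
    (hkmeas.mul (Measurable.aestronglyMeasurable
      (Measurable.indicator (by fun_prop) measurableSet_Iio)))
    (.of_forall fun t ht => by
      rw [uIoc_of_le hT0] at ht
      refine LipschitzOnWith.of_dist_le_mul fun y hy z hz => ?_
      have hmem : ∀ y ∈ Ioo a (x + 1), max (y - t) a ∈ Icc a (x + 1) := fun y hy =>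
        ⟨le_max_right _ _, max_le (by linarith [hy.2, ht.1]) (by linarith)⟩
      have h := hC.dist_le_mul _ (hmem y hy) _ (hmem z hz)
      have hmax := abs_max_sub_max_le_abs (y - t) (z - t) a
      rw [sub_sub_sub_cancel_right] at hmax
      simp only [Real.dist_eq] at h ⊢
      simp only [w, ← mul_sub, sub_sub_sub_cancel_right, abs_mul, Real.coe_nnabs, NNReal.abs_eq]
      calc |k t| * |v (max (y - t) a) - v (max (z - t) a)|
          ≤ |k t| * (C * |y - z|) := by gcongr; exact h.trans (by gcongr)
        _ = C * |k t| * |y - z| := by ring)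
    ((hk T hT0).const_mul _)
    (by
      have hne : ∀ᵐ t : ℝ, t ≠ x - a := by simp [ae_iff]
      filter_upwards [hne] with t ht _
      refine HasDerivAt.const_mul (k t) ?_
      rcases lt_or_gt_of_ne ht with hlt | hgt
      · rw [indicator_of_mem (show t ∈ Iio (x - a) from hlt)]
        refine (((hv (x - t)).comp_sub_const x t).sub_const (v a)).congr_of_eventuallyEq ?_
        filter_upwards [Ioi_mem_nhds (show a + t < x by linarith)] with y hy
        have hy : a + t < y := hy
        simp only [w, max_eq_left (show a ≤ y - t by linarith)]
      · rw [indicator_of_notMem (show t ∉ Iio (x - a) from not_lt.2 hgt.le)]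
        refine (hasDerivAt_const x (0 : ℝ)).congr_of_eventuallyEq ?_
        filter_upwards [Iio_mem_nhds (show x < a + t by linarith)] with y hy
        have hy : y < a + t := hy
        simp only [w, max_eq_right (show y - t ≤ a by linarith), sub_self])).2
  have hval : ∫ t in (0 : ℝ)..T, k t * (Iio (x - a)).indicator (fun t => v' (x - t)) t
      = ∫ s in a..x, k (x - s) * v' s := by
    have hcv := intervalIntegral.integral_comp_sub_left (a := a) (b := x)
      (fun t => k t * v' (x - t)) x
    simp only [sub_sub_cancel, sub_self] at hcv
    rw [hcv, intervalIntegral.integral_of_le hT0, intervalIntegral.integral_of_le hxa0.le,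
      integral_Ioc_eq_integral_Ioo (y := x - a)]
    simp only [← indicator_mul_right]
    rw [setIntegral_indicator measurableSet_Iio]
    congr 2
    ext t
    simp only [mem_inter_iff, mem_Ioc, mem_Iio, mem_Ioo]
    constructor
    · exact fun h => ⟨h.1.1, h.2⟩
    · exact fun h => ⟨⟨h.1, by linarith⟩, h.2⟩
  rw [hval] at hder2
  rw [mul_comm (k (x - a))]
  refine (hder1.add hder2).congr_of_eventuallyEq ?_
  filter_upwards [hnhds] with y hy using hsplit y hy

theorem exists_hasDerivAt_eqOn_Icc {f g : ℝ → ℝ} {a b : ℝ}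
    (hf : DifferentiableOn ℝ f (Icc a b)) (hg : Continuous g)
    (hfg : EqOn g (derivWithin f (Icc a b)) (Icc a b)) :
    ∃ v : ℝ → ℝ, (∀ s, HasDerivAt v (g s) s) ∧ EqOn v f (Icc a b) := by
  refine ⟨fun s => f a + ∫ r in a..s, g r,
    fun s => (hg.integral_hasStrictDerivAt a s).hasDerivAt.const_add _, fun s hs => ?_⟩
  have h := intervalIntegral.integral_eq_sub_of_hasDerivAt_of_le (f := f) (f' := g) hs.1
    (hf.continuousOn.mono (Icc_subset_Icc_right hs.2)) (fun r hr => ?_) (hg.intervalIntegrable a s)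
  · simp only [h, add_sub_cancel]
  · have hr' : r ∈ Ioo a b := ⟨hr.1, hr.2.trans_le hs.2⟩
    rw [hfg (Ioo_subset_Icc_self hr')]
    exact (hf r (Ioo_subset_Icc_self hr')).hasDerivWithinAt.hasDerivAt (Icc_mem_nhds hr'.1 hr'.2)

theorem ContDiffOn.exists_extension_Icc {u : ℝ → ℝ} {a b : ℝ} (hab : a < b)
    (hu : ContDiffOn ℝ 2 u (Icc a b)) :
    ∃ v v' v'' : ℝ → ℝ, (∀ s, HasDerivAt v (v' s) s) ∧ (∀ s, HasDerivAt v' (v'' s) s) ∧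
      Continuous v'' ∧ EqOn v u (Icc a b) ∧ EqOn v' (derivWithin u (Icc a b)) (Icc a b) ∧
      EqOn v'' (derivWithin (derivWithin u (Icc a b)) (Icc a b)) (Icc a b) := by
  have hI := uniqueDiffOn_Icc hab
  have hu1 : ContDiffOn ℝ 1 (derivWithin u (Icc a b)) (Icc a b) :=
    hu.derivWithin hI (by norm_num)
  have hc := hu1.continuousOn_derivWithin hI le_rfl
  have hg : Continuous (IccExtend hab.le
      ((Icc a b).domRestrict (derivWithin (derivWithin u (Icc a b)) (Icc a b)))) :=
    hc.domRestrict.Icc_extend'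
  have hge : EqOn (IccExtend hab.le
      ((Icc a b).domRestrict (derivWithin (derivWithin u (Icc a b)) (Icc a b))))
      (derivWithin (derivWithin u (Icc a b)) (Icc a b)) (Icc a b) := fun s hs => by
    rw [IccExtend_of_mem _ _ hs, domRestrict_apply]
  obtain ⟨v', hv', hv'e⟩ :=
    exists_hasDerivAt_eqOn_Icc (hu1.differentiableOn (by norm_num)) hg hge
  obtain ⟨v, hv, hve⟩ := exists_hasDerivAt_eqOn_Icc (hu.differentiableOn (by norm_num))
    (continuous_iff_continuousAt.2 fun s => (hv' s).continuousAt) hv'e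
  exact ⟨v, v', _, hv, hv', hg, hve, hv'e, hge⟩

/-- Two functions that agree to the left of `x`, whose derivatives are differentiable at `x`, have
the same second derivative at `x`. -/
theorem eq_of_hasDerivAt_deriv_of_eqOn_Ioo {f g : ℝ → ℝ} {a x D E : ℝ} (hax : a < x)
    (hfg : EqOn f g (Ioo a x)) (hf : HasDerivAt (deriv f) D x) (hg : HasDerivAt (deriv g) E x) :
    D = E := by
  have heq : deriv f =ᶠ[𝓝[<] x] deriv g := by
    filter_upwards [Ioo_mem_nhdsLT hax] with y hy
    exact (hfg.eventuallyEq_of_mem (Ioo_mem_nhds hy.1 hy.2)).deriv_eq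
  have hval : deriv f x = deriv g x :=
    tendsto_nhds_unique ((hf.continuousAt.tendsto.mono_left nhdsWithin_le_nhds).congr' heq)
      (hg.continuousAt.tendsto.mono_left nhdsWithin_le_nhds)
  exact (uniqueDiffWithinAt_Iio x).eq_deriv _ hf.hasDerivWithinAt
    (hg.hasDerivWithinAt.congr_of_eventuallyEq heq hval)

/-- Lemma 2.1, Part B of the paper.
For `1 < σ < 2`, `u` twice continuously differentiable on `[a,b]`, and `x ∈ (a,b]`,
if the second derivative defining the left-sided Riemann–Liouville-type Log-Pow operator
of order `σ` exists at `x` (with value `D`), then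
`(1/Γ(2-σ)) D = u(a)(1+(1-σ)log(x-a))/(Γ(2-σ)(x-a)^σ)
  + u'(a) log(x-a)/(Γ(2-σ)(x-a)^{σ-1})
  + (1/Γ(2-σ)) ∫_a^x log(x-s)(x-s)^{1-σ} u''(s) ds`. -/
theorem stmt1 (σ a b : ℝ) (hσ1 : 1 < σ) (hσ2 : σ < 2) (hab : a < b)
    (u : ℝ → ℝ) (hu : ContDiffOn ℝ 2 u (Set.Icc a b))
    (x : ℝ) (hx : x ∈ Set.Ioc a b)
    (D : ℝ)
    (hD : HasDerivAt
      (deriv (fun y => ∫ s in a..y, Real.log (y - s) * (y - s) ^ (1 - σ) * u s)) D x) :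
    (1 / Real.Gamma (2 - σ)) * D
      = u a * (1 + (1 - σ) * Real.log (x - a)) / (Real.Gamma (2 - σ) * (x - a) ^ σ)
        + derivWithin u (Set.Icc a b) a * Real.log (x - a)
            / (Real.Gamma (2 - σ) * (x - a) ^ (σ - 1))
        + (1 / Real.Gamma (2 - σ)) *
            ∫ s in a..x, Real.log (x - s) * (x - s) ^ (1 - σ) *
              derivWithin (derivWithin u (Set.Icc a b)) (Set.Icc a b) s := by
  obtain ⟨v, v', v'', hv, hv', hv''c, hve, hv'e, hv''e⟩ := hu.exists_extension_Icc hab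
  have hv'c : Continuous v' := continuous_iff_continuousAt.2 fun s => (hv' s).continuousAt
  have hxa : 0 < x - a := by linarith [hx.1]
  set k : ℝ → ℝ := fun t => Real.log t * t ^ (1 - σ) with hkdef
  have hk : ∀ T, 0 ≤ T → IntervalIntegrable k volume 0 T := fun T hT =>
    intervalIntegrable_log_mul_rpow (by linarith) hT
  have hkd : ∀ t, 0 < t → HasDerivAt k ((1 + (1 - σ) * Real.log t) / t ^ σ) t := by
    intro t ht
    refine ((Real.hasDerivAt_log ht.ne').mul
      (Real.hasDerivAt_rpow_const (p := 1 - σ) (Or.inl ht.ne'))).congr_deriv ?_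
    rw [show 1 - σ - 1 = -σ by ring, sub_eq_add_neg, Real.rpow_add ht, Real.rpow_one,
      Real.rpow_neg ht.le]
    field_simp
  have hkc : ContinuousOn k (Ioi 0) := fun t ht => (hkd t ht).continuousAt.continuousWithinAt
  have hF1 : ∀ y, a < y → HasDerivAt (fun y => ∫ s in a..y, k (y - s) * v s)
      (k (y - a) * v a + ∫ s in a..y, k (y - s) * v' s) y := fun y hy =>
    hasDerivAt_integral_kernel_sub_mul hk hkc hv hv'c hy
  have hF2 : HasDerivAt (deriv fun y => ∫ s in a..y, k (y - s) * v s)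
      ((1 + (1 - σ) * Real.log (x - a)) / (x - a) ^ σ * v a
        + (k (x - a) * v' a + ∫ s in a..x, k (x - s) * v'' s)) x := by
    refine ((((hkd _ hxa).comp_sub_const x a).mul_const (v a)).add
      (hasDerivAt_integral_kernel_sub_mul hk hkc hv' hv''c hx.1)).congr_of_eventuallyEq ?_
    filter_upwards [Ioi_mem_nhds hx.1] with y hy using (hF1 y hy).deriv
  have hcongr : EqOn (fun y => ∫ s in a..y, k (y - s) * u s)
      (fun y => ∫ s in a..y, k (y - s) * v s) (Ioo a x) := by
    intro y hy
    refine intervalIntegral.integral_congr fun s hs => ?_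
    rw [uIcc_of_le hy.1.le] at hs
    simp only [hve ⟨hs.1, hs.2.trans (hy.2.le.trans hx.2)⟩]
  have hint : ∫ s in a..x, k (x - s) * v'' s
      = ∫ s in a..x, k (x - s) * derivWithin (derivWithin u (Icc a b)) (Icc a b) s := by
    refine intervalIntegral.integral_congr fun s hs => ?_
    rw [uIcc_of_le hx.1.le] at hs
    simp only [hv''e ⟨hs.1, hs.2.trans hx.2⟩]
  have ha : a ∈ Icc a b := left_mem_Icc.2 hab.le
  rw [eq_of_hasDerivAt_deriv_of_eqOn_Ioo hx.1 hcongr hD hF2, hint, hve ha, hv'e ha]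
  have hkx : k (x - a) = Real.log (x - a) / (x - a) ^ (σ - 1) := by
    simp only [hkdef]
    rw [← neg_sub σ 1, Real.rpow_neg hxa.le, div_eq_mul_inv]
  have hΓ : Real.Gamma (2 - σ) ≠ 0 := (Real.Gamma_pos_of_pos (by linarith)).ne'
  have hpow1 : (x - a) ^ σ ≠ 0 := (Real.rpow_pos_of_pos hxa _).ne'
  have hpow2 : (x - a) ^ (σ - 1) ≠ 0 := (Real.rpow_pos_of_pos hxa _).ne'
  rw [hkx]
  field_simp
  ring
end

section
/- Let a < b, x ∈ (a,b], and let u : (0,1) × [a,b] → ℝ be jointly continuous with jointly continuous partial derivative ∂u/∂σ. Fix σ₀ ∈ (0,1) and set I(σ,y) = ∫_a^y (y−s)^{−σ} u(σ,s) ds. Assume I has partial derivatives ∂I/∂x and ∂I/∂σ in a neighborhood of (σ₀,x), that the mixed second partial derivatives of I exist at (σ₀,x) and commute, and that the maps y ↦ ∫_a^y (y−s)^{−σ₀}·(∂u/∂σ)(σ₀,s) ds and y ↦ ∫_a^y log(y−s)·(y−s)^{−σ₀}·u(σ₀,s) ds are differentiable at y = x. Then the map σ ↦ (1/Γ(1−σ))·(∂I/∂x)(σ,x)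 is differentiable at σ₀ with derivative (1/Γ(1−σ₀)) · d/dx ∫_a^x (x−s)^{−σ₀}·(∂u/∂σ)(σ₀,s) ds + A₁(σ₀) · (1/Γ(1−σ₀))·(∂I/∂x)(σ₀,x) − (1/Γ(1−σ₀)) · d/dx ∫_a^x log(x−s)·(x−s)^{−σ₀}·u(σ₀,s) ds, where A₁(σ) := Γ(1−σ) · (d/dσ)(1/Γ(1−σ)). -/
/-- Interpolation of real powers between the exponents `-m` and `1`. -/
theorem rpow_le_rpow_neg_add_self {r m t : ℝ} (hr : 0 < r) (hm : -m ≤ t) (ht : t ≤ 1) :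
    r ^ t ≤ r ^ (-m) + r := by
  rcases le_total r 1 with h | h
  · have := Real.rpow_le_rpow_of_exponent_ge hr h hm
    linarith
  · have := Real.rpow_le_rpow_of_exponent_le h ht
    rw [Real.rpow_one] at this
    have := (Real.rpow_pos_of_pos hr (-m)).le
    linarith

theorem abs_log_mul_rpow_neg_le {r m t ε : ℝ} (hr : 0 < r) (hε : 0 < ε) (hm : t + ε ≤ m)
    (ht : ε - t ≤ 1) :
    |Real.log r * r ^ (-t)| ≤ 2 / ε * (r ^ (-m) + r) := by
  have hlog : |Real.log r| ≤ (r ^ ε + r ^ (-ε)) / ε := by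
    have h1 := Real.log_le_rpow_div hr.le hε
    have h2 := Real.log_le_rpow_div (inv_pos.2 hr).le hε
    rw [Real.log_inv, Real.inv_rpow hr.le, ← Real.rpow_neg hr.le] at h2
    have h3 : 0 < r ^ ε / ε := by positivity
    have h4 : 0 < r ^ (-ε) / ε := by positivity
    rw [add_div, abs_le]
    constructor <;> linarith
  have hp : 0 < r ^ (-t) := Real.rpow_pos_of_pos hr _
  rw [abs_mul, abs_of_pos hp]
  calc |Real.log r| * r ^ (-t) ≤ (r ^ ε + r ^ (-ε)) / ε * r ^ (-t) := by gcongr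
    _ = (r ^ (ε - t) + r ^ (-ε - t)) / ε := by
        rw [sub_eq_add_neg, sub_eq_add_neg, Real.rpow_add hr, Real.rpow_add hr]; ring
    _ ≤ ((r ^ (-m) + r) + (r ^ (-m) + r)) / ε := by
        gcongr
        · exact rpow_le_rpow_neg_add_self hr (by linarith) ht
        · exact rpow_le_rpow_neg_add_self hr (by linarith) (by linarith)
    _ = 2 / ε * (r ^ (-m) + r) := by ring

theorem rpow_neg_sub_add_self_intervalIntegrable {a y m : ℝ} (hm : m < 1) :
    IntervalIntegrable (fun s => (y - s) ^ (-m) + (y - s)) MeasureTheory.volume a y := by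
  have h := (intervalIntegral.intervalIntegrable_rpow' (a := y - a) (b := 0)
    (show -1 < -m by linarith)).comp_sub_left y
  simp only [sub_sub_cancel, sub_zero] at h
  exact h.add (Continuous.intervalIntegrable (by fun_prop) _ _)

open MeasureTheory Set in
/-- Differentiation of a weakly singular integral with respect to the order of its kernel. -/
theorem hasDerivAt_integral_rpow_neg_order {a b y : ℝ} (hy : y ∈ Ioc a b) {u uσ : ℝ → ℝ → ℝ}
    (hcont : ContinuousOn (fun p : ℝ × ℝ => u p.1 p.2) (Ioo 0 1 ×ˢ Icc a b))
    (huσ : ∀ σ ∈ Ioo (0:ℝ) 1, ∀ s ∈ Icc a b, HasDerivAt (fun τ => u τ s) (uσ σ s) σ)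
    (hcontσ : ContinuousOn (fun p : ℝ × ℝ => uσ p.1 p.2) (Ioo 0 1 ×ˢ Icc a b))
    {σ₀ : ℝ} (hσ₀ : σ₀ ∈ Ioo (0:ℝ) 1) :
    HasDerivAt (fun τ => ∫ s in a..y, (y - s) ^ (-τ) * u τ s)
      ((∫ s in a..y, (y - s) ^ (-σ₀) * uσ σ₀ s)
        - ∫ s in a..y, Real.log (y - s) * (y - s) ^ (-σ₀) * u σ₀ s) σ₀ := by
  obtain ⟨hσ0, hσ1⟩ := hσ₀
  obtain ⟨ε, hε, hε0, hε1⟩ : ∃ ε > 0, 4 * ε ≤ σ₀ ∧ 4 * ε ≤ 1 - σ₀ :=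
    ⟨min σ₀ (1 - σ₀) / 4, by have := lt_min hσ0 (sub_pos.2 hσ1); positivity,
      by linarith [min_le_left σ₀ (1 - σ₀)], by linarith [min_le_right σ₀ (1 - σ₀)]⟩
  have hsub : Icc (σ₀ - ε) (σ₀ + ε) ⊆ Ioo 0 1 := fun t ht =>
    ⟨by linarith [ht.1], by linarith [ht.2]⟩
  have hK : IsCompact (Icc (σ₀ - ε) (σ₀ + ε) ×ˢ Icc a b) := isCompact_Icc.prod isCompact_Icc
  obtain ⟨C, hC⟩ := hK.exists_bound_of_continuousOn
    (hcont.mono (prod_mono hsub Subset.rfl))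
  obtain ⟨C', hC'⟩ := hK.exists_bound_of_continuousOn
    (hcontσ.mono (prod_mono hsub Subset.rfl))
  set m := σ₀ + 2 * ε with hmdef
  have hball : ∀ t ∈ Metric.ball σ₀ ε, t ∈ Icc (σ₀ - ε) (σ₀ + ε) := fun t ht => by
    rw [Real.ball_eq_Ioo] at ht; exact Ioo_subset_Icc_self ht
  have hmeas : ∀ {v : ℝ → ℝ → ℝ},
      ContinuousOn (fun p : ℝ × ℝ => v p.1 p.2) (Ioo 0 1 ×ˢ Icc a b) →
      ∀ t ∈ Icc (σ₀ - ε) (σ₀ + ε),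
        AEStronglyMeasurable (v t) (volume.restrict (uIoc a y)) := by
    intro v hv t ht
    have hc : ContinuousOn (v t) (Icc a b) :=
      hv.comp (f := fun s => (t, s)) (by fun_prop) fun s hs => ⟨hsub ht, hs⟩
    refine (hc.mono ?_).aestronglyMeasurable measurableSet_uIoc
    rw [uIoc_of_le hy.1.le]
    exact fun s hs => ⟨hs.1.le, hs.2.trans hy.2⟩
  have hker : ∀ t : ℝ, AEStronglyMeasurable (fun s => (y - s) ^ (-t))
      (volume.restrict (uIoc a y)) := fun t =>
    ((measurable_const.sub measurable_id).pow_const _).aestronglyMeasurable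
  have hlogker : ∀ t : ℝ, AEStronglyMeasurable (fun s => Real.log (y - s) * (y - s) ^ (-t))
      (volume.restrict (uIoc a y)) := fun t =>
    (Real.measurable_log.comp (measurable_const.sub measurable_id)).aestronglyMeasurable.mul
      (hker t)
  have hae : ∀ {P : ℝ → Prop}, (∀ s ∈ Icc a b, 0 < y - s → P s) →
      ∀ᵐ s, s ∈ uIoc a y → P s := by
    intro P hP
    filter_upwards [compl_mem_ae_iff.2 (measure_singleton (μ := volume) y)] with s hsy hs
    rw [uIoc_of_le hy.1.le] at hs
    exact hP s ⟨hs.1.le, hs.2.trans hy.2⟩ (sub_pos.2 (lt_of_le_of_ne hs.2 hsy))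
  have hb : ∀ K : ℝ, IntervalIntegrable (fun s => K * ((y - s) ^ (-m) + (y - s)))
      volume a y := fun K =>
    (rpow_neg_sub_add_self_intervalIntegrable (by linarith)).const_mul K
  have hbound : ∀ {v : ℝ → ℝ → ℝ} {B : ℝ},
      (∀ p ∈ Icc (σ₀ - ε) (σ₀ + ε) ×ˢ Icc a b, ‖v p.1 p.2‖ ≤ B) →
      ∀ s ∈ Icc a b, 0 < y - s → ∀ t ∈ Icc (σ₀ - ε) (σ₀ + ε),
        ‖(y - s) ^ (-t) * v t s‖ ≤ B * ((y - s) ^ (-m) + (y - s)) := by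
    intro v B hB s hs hr t ht
    have h1 := rpow_le_rpow_neg_add_self (m := m) (t := -t) hr (by linarith [ht.2])
      (by linarith [ht.1])
    have hp : 0 < (y - s) ^ (-t) := Real.rpow_pos_of_pos hr _
    rw [norm_mul, Real.norm_of_nonneg hp.le, mul_comm B]
    exact mul_le_mul h1 (hB (t, s) ⟨ht, hs⟩) (norm_nonneg _) (hp.le.trans h1)
  have hlogbound : ∀ s ∈ Icc a b, 0 < y - s → ∀ t ∈ Icc (σ₀ - ε) (σ₀ + ε),
      ‖Real.log (y - s) * (y - s) ^ (-t) * u t s‖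
        ≤ 2 / ε * C * ((y - s) ^ (-m) + (y - s)) := by
    intro s hs hr t ht
    have h1 := abs_log_mul_rpow_neg_le (m := m) (t := t) hr hε (by linarith [ht.2])
      (by linarith [ht.1])
    rw [norm_mul, mul_right_comm]
    exact mul_le_mul h1 (hC (t, s) ⟨ht, hs⟩) (norm_nonneg _) ((abs_nonneg _).trans h1)
  have hint : ∀ {g : ℝ → ℝ} {K : ℝ}, AEStronglyMeasurable g (volume.restrict (uIoc a y)) →
      (∀ s ∈ Icc a b, 0 < y - s → ‖g s‖ ≤ K * ((y - s) ^ (-m) + (y - s))) →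
      IntervalIntegrable g volume a y := fun {g K} hg hle =>
    (hb K).mono_fun' hg ((ae_restrict_iff' measurableSet_uIoc).2 (hae hle))
  have hσmem : σ₀ ∈ Icc (σ₀ - ε) (σ₀ + ε) := ⟨by linarith, by linarith⟩
  have hi1 : IntervalIntegrable (fun s => (y - s) ^ (-σ₀) * uσ σ₀ s) volume a y :=
    hint ((hker σ₀).mul (hmeas hcontσ σ₀ hσmem)) fun s hs hr => hbound hC' s hs hr σ₀ hσmem
  have hi2 : IntervalIntegrable (fun s => Real.log (y - s) * (y - s) ^ (-σ₀) * u σ₀ s)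
      volume a y :=
    hint ((hlogker σ₀).mul (hmeas hcont σ₀ hσmem)) fun s hs hr => hlogbound s hs hr σ₀ hσmem
  rw [← intervalIntegral.integral_sub hi1 hi2]
  refine (intervalIntegral.hasDerivAt_integral_of_dominated_loc_of_deriv_le
    (F' := fun t s => (y - s) ^ (-t) * uσ t s - Real.log (y - s) * (y - s) ^ (-t) * u t s)
    (bound := fun s => C' * ((y - s) ^ (-m) + (y - s))
      + 2 / ε * C * ((y - s) ^ (-m) + (y - s)))
    (Metric.ball_mem_nhds σ₀ hε) ?_ ?_ (hi1.sub hi2).aestronglyMeasurable_restrict_uIoc ?_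
    ((hb _).add (hb _)) ?_).2
  · filter_upwards [Metric.ball_mem_nhds σ₀ hε] with t ht
    exact (hker t).mul (hmeas hcont t (hball t ht))
  · exact hint ((hker σ₀).mul (hmeas hcont σ₀ hσmem)) fun s hs hr => hbound hC s hs hr σ₀ hσmem
  · exact hae fun s hs hr t ht => (norm_sub_le _ _).trans
      (add_le_add (hbound hC' s hs hr t (hball t ht)) (hlogbound s hs hr t (hball t ht)))
  · refine hae fun s hs hr t ht => ?_
    have h1 : HasDerivAt (fun τ : ℝ => (y - s) ^ (-τ))
        (-(Real.log (y - s) * (y - s) ^ (-t))) t :=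
      ((hasDerivAt_neg t).const_rpow hr).congr_deriv (by ring)
    exact (h1.fun_mul (huσ t (hsub (hball t ht)) s hs)).congr_deriv (by ring)


/-- equation (4.2) of the paper, case `n = 1`.
Sensitivity of the left-sided Riemann–Liouville fractional derivative with respect to
its order: with `I(σ,y) = ∫_a^y (y-s)^{-σ} u(σ,s) ds`, `Ix = ∂I/∂x`, `Iσ = ∂I/∂σ`
(valid on a neighborhood `V` of `(σ₀,x)`), commuting mixed second partials (common
value `M`), and with `D1`, `D2` the derivatives at `x` of
`y ↦ ∫_a^y (y-s)^{-σ₀} (∂u/∂σ)(σ₀,s) ds` and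
`y ↦ ∫_a^y log(y-s)(y-s)^{-σ₀} u(σ₀,s) ds`, the map
`σ ↦ (1/Γ(1-σ)) Ix(σ,x)` is differentiable at `σ₀` with derivative
`(1/Γ(1-σ₀)) D1 + A₁(σ₀)(1/Γ(1-σ₀)) Ix(σ₀,x) - (1/Γ(1-σ₀)) D2`, where
`A₁(σ) = Γ(1-σ) (d/dσ)(1/Γ(1-σ))`. -/
theorem stmt2 (a b : ℝ) (hab : a < b) (x : ℝ) (hx : x ∈ Set.Ioc a b)
    (u uσ : ℝ → ℝ → ℝ)
    (hcont : ContinuousOn (fun p : ℝ × ℝ => u p.1 p.2) (Set.Ioo 0 1 ×ˢ Set.Icc a b))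
    (huσ : ∀ σ ∈ Set.Ioo (0:ℝ) 1, ∀ s ∈ Set.Icc a b,
      HasDerivAt (fun τ => u τ s) (uσ σ s) σ)
    (hcontσ : ContinuousOn (fun p : ℝ × ℝ => uσ p.1 p.2) (Set.Ioo 0 1 ×ˢ Set.Icc a b))
    (σ₀ : ℝ) (hσ₀ : σ₀ ∈ Set.Ioo (0:ℝ) 1)
    (Ix Iσ : ℝ → ℝ → ℝ)
    (V : Set (ℝ × ℝ)) (hV : V ∈ nhds (σ₀, x))
    (hIx : ∀ p ∈ V,
      HasDerivAt (fun y => ∫ s in a..y, (y - s) ^ (-p.1) * u p.1 s) (Ix p.1 p.2) p.2)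
    (hIσ : ∀ p ∈ V,
      HasDerivAt (fun τ => ∫ s in a..p.2, (p.2 - s) ^ (-τ) * u τ s) (Iσ p.1 p.2) p.1)
    (M : ℝ)
    (hM1 : HasDerivAt (fun τ => Ix τ x) M σ₀)
    (hM2 : HasDerivAt (fun y => Iσ σ₀ y) M x)
    (D1 D2 : ℝ)
    (hD1 : HasDerivAt (fun y => ∫ s in a..y, (y - s) ^ (-σ₀) * uσ σ₀ s) D1 x)
    (hD2 : HasDerivAt
      (fun y => ∫ s in a..y, Real.log (y - s) * (y - s) ^ (-σ₀) * u σ₀ s) D2 x) :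
    HasDerivAt (fun σ => (1 / Real.Gamma (1 - σ)) * Ix σ x)
      ((1 / Real.Gamma (1 - σ₀)) * D1
        + (Real.Gamma (1 - σ₀) * deriv (fun τ => 1 / Real.Gamma (1 - τ)) σ₀)
            * ((1 / Real.Gamma (1 - σ₀)) * Ix σ₀ x)
        - (1 / Real.Gamma (1 - σ₀)) * D2) σ₀ := by
  have hσV : ∀ᶠ y in nhds x, (σ₀, y) ∈ V :=
    (Continuous.prodMk_right σ₀).continuousAt.preimage_mem_nhds hV
  have heq : ∀ y ∈ Set.Ioc a b, (σ₀, y) ∈ V →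
      Iσ σ₀ y = (∫ s in a..y, (y - s) ^ (-σ₀) * uσ σ₀ s)
        - ∫ s in a..y, Real.log (y - s) * (y - s) ^ (-σ₀) * u σ₀ s := fun y hy hyV =>
    (hIσ (σ₀, y) hyV).unique (hasDerivAt_integral_rpow_neg_order hy hcont huσ hcontσ hσ₀)
  have hleft : HasDerivWithinAt (fun y => Iσ σ₀ y) (D1 - D2) (Set.Iic x) x := by
    refine (hD1.sub hD2).hasDerivWithinAt.congr_of_eventuallyEq ?_ (heq x hx hσV.self_of_nhds)
    filter_upwards [self_mem_nhdsWithin, nhdsWithin_le_nhds hσV,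
      nhdsWithin_le_nhds (lt_mem_nhds hx.1)] with y hyx hyV hay
    exact heq y ⟨hay, le_trans hyx hx.2⟩ hyV
  have hM : M = D1 - D2 :=
    (uniqueDiffWithinAt_Iic x).eq_deriv _ hM2.hasDerivWithinAt hleft
  have hpos : 0 < 1 - σ₀ := sub_pos.2 hσ₀.2
  have hΓ : Real.Gamma (1 - σ₀) ≠ 0 := (Real.Gamma_pos_of_pos hpos).ne'
  have hdΓ : DifferentiableAt ℝ (fun τ => 1 / Real.Gamma (1 - τ)) σ₀ := by
    have h : DifferentiableAt ℝ Real.Gamma (1 - σ₀) := Real.differentiableAt_Gamma fun k => by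
      have : (0:ℝ) ≤ k := k.cast_nonneg
      linarith
    exact (differentiableAt_const _).div
      (h.comp σ₀ (differentiableAt_id.const_sub 1)) hΓ
  refine (hdΓ.hasDerivAt.fun_mul hM1).congr_deriv ?_
  rw [hM]
  field_simp
  ring
end

section
/- Let a < b, x ∈ [a,b), and let u : (0,1) × [a,b] → ℝ be jointly continuous with jointly continuous partial derivative ∂u/∂σ. Fix σ₀ ∈ (0,1) and set J(σ,y) = ∫_y^b (s−y)^{−σ} u(σ,s) ds. Assume J has partial derivatives ∂J/∂x and ∂J/∂σ in a neighborhood of (σ₀,x), that the mixed second partial derivatives of J exist at (σ₀,x) and commute, and that the maps y ↦ ∫_y^b (s−y)^{−σ₀}·(∂u/∂σ)(σ₀,s) ds and y ↦ ∫_y^b log(s−y)·(s−y)^{−σ₀}·u(σ₀,s) ds are differentiable at y = x. Then the map σ ↦ (−1/Γ(1−σ))·(∂J/∂x)(σ,x) is differentiable at σ₀ with derivative (−1/Γ(1−σ₀)) · d/dx ∫_x^b (s−x)^{−σ₀}·(∂u/∂σ)(σ₀,s) ds + A₁(σ₀) · (−1/Γ(1−σ₀))·(∂J/∂x)(σ₀,x)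 − (−1/Γ(1−σ₀)) · d/dx ∫_x^b log(s−x)·(s−x)^{−σ₀}·u(σ₀,s) ds, where A₁(σ) := Γ(1−σ) · (d/dσ)(1/Γ(1−σ)). -/
/-- An intermediate power of a positive number is at most the sum of the two outer powers. -/
theorem rpow_le_rpow_add_rpow {t p e q : ℝ} (ht : 0 < t) (hpe : p ≤ e) (heq : e ≤ q) :
    t ^ e ≤ t ^ p + t ^ q := by
  have hp := Real.rpow_pos_of_pos ht p
  have hq := Real.rpow_pos_of_pos ht q
  rcases le_total t 1 with h | h
  · linarith [Real.rpow_le_rpow_of_exponent_ge ht h hpe]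
  · linarith [Real.rpow_le_rpow_of_exponent_le h heq]

theorem abs_log_le_rpow_add_rpow_div {t δ : ℝ} (ht : 0 < t) (hδ : 0 < δ) :
    |Real.log t| ≤ (t ^ (-δ) + t ^ δ) / δ := by
  have h1 := Real.log_le_rpow_div ht.le hδ
  have h2 := Real.log_le_rpow_div (inv_pos.2 ht).le hδ
  rw [Real.log_inv, Real.inv_rpow ht.le, ← Real.rpow_neg ht.le] at h2
  have hp := div_pos (Real.rpow_pos_of_pos ht δ) hδ
  have hn := div_pos (Real.rpow_pos_of_pos ht (-δ)) hδ
  rw [add_div, abs_le]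
  constructor <;> linarith

/-- The kernels `t ^ (-τ)` and `log t * t ^ (-τ)` have a common majorant, integrable at `0`,
for `τ` in a compact subinterval of `[0, 1)`. -/
theorem exists_majorant_rpow_log {σ : ℝ} (hσ0 : 0 < σ) (hσ1 : σ < 1) :
    ∃ K ρ : ℝ, -1 < ρ ∧ ∀ t : ℝ, 0 < t → ∀ τ : ℝ, 0 ≤ τ → τ ≤ σ →
      |t ^ (-τ)| ≤ K * (t ^ ρ + t) ∧ |Real.log t * t ^ (-τ)| ≤ K * (t ^ ρ + t) := by
  set δ := (1 - σ) / 2 with hδ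
  have hδ0 : 0 < δ := by linarith
  refine ⟨1 + 2 / δ, -(σ + δ), by linarith, fun t ht τ hτ0 hτσ => ?_⟩
  have key : ∀ e : ℝ, -(σ + δ) ≤ e → e ≤ 1 → t ^ e ≤ t ^ (-(σ + δ)) + t := fun e h1 h2 => by
    simpa using rpow_le_rpow_add_rpow ht h1 h2
  set B := t ^ (-(σ + δ)) + t
  have hB : 0 < B := by positivity
  have hp := Real.rpow_pos_of_pos ht (-τ)
  constructor
  · rw [abs_of_pos hp]
    have := key (-τ) (by linarith) (by linarith)
    have : 0 ≤ 2 / δ * B := by positivity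
    linarith
  · rw [abs_mul, abs_of_pos hp]
    calc |Real.log t| * t ^ (-τ) ≤ (t ^ (-δ) + t ^ δ) / δ * t ^ (-τ) := by
          gcongr
          exact abs_log_le_rpow_add_rpow_div ht hδ0
      _ = (t ^ (-δ + -τ) + t ^ (δ + -τ)) / δ := by
          rw [Real.rpow_add ht, Real.rpow_add ht]
          ring
      _ ≤ (B + B) / δ := by
          gcongr
          · exact key _ (by linarith) (by linarith)
          · exact key _ (by linarith) (by linarith)
      _ = 2 / δ * B := by ring
      _ ≤ (1 + 2 / δ) * B := by linarith

theorem intervalIntegrable_rpow_sub_add {ρ : ℝ} (hρ : -1 < ρ) (y b : ℝ) :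
    IntervalIntegrable (fun s => (s - y) ^ ρ + (s - y)) MeasureTheory.volume y b := by
  refine IntervalIntegrable.add ?_ (Continuous.intervalIntegrable (by fun_prop) _ _)
  have h := (intervalIntegral.intervalIntegrable_rpow' (a := 0) (b := b - y) hρ).comp_sub_right y
  simpa using h

theorem intervalIntegrable_of_continuousOn_of_le_rpow {y b ρ C : ℝ} {f : ℝ → ℝ} (hyb : y ≤ b)
    (hρ : -1 < ρ) (hf : ContinuousOn f (Set.Ioc y b))
    (hle : ∀ s ∈ Set.Ioc y b, |f s| ≤ C * ((s - y) ^ ρ + (s - y))) :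
    IntervalIntegrable f MeasureTheory.volume y b := by
  refine ((intervalIntegrable_rpow_sub_add hρ y b).const_mul C).mono_fun' ?_ ?_
  · rw [Set.uIoc_of_le hyb]
    exact hf.aestronglyMeasurable measurableSet_Ioc
  · rw [Set.uIoc_of_le hyb]
    exact (MeasureTheory.ae_restrict_iff' measurableSet_Ioc).2 (.of_forall hle)

/-- Differentiation under the integral sign of a right-sided fractional integral with respect to
its order. -/
theorem hasDerivAt_integral_rpow_order {y b σ₀ : ℝ} (hyb : y ≤ b) (hσ₀ : σ₀ ∈ Set.Ioo (0 : ℝ) 1)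
    {u uσ : ℝ → ℝ → ℝ}
    (hcont : ContinuousOn (fun p : ℝ × ℝ => u p.1 p.2) (Set.Ioo 0 1 ×ˢ Set.Icc y b))
    (huσ : ∀ σ ∈ Set.Ioo (0 : ℝ) 1, ∀ s ∈ Set.Icc y b,
      HasDerivAt (fun τ => u τ s) (uσ σ s) σ)
    (hcontσ : ContinuousOn (fun p : ℝ × ℝ => uσ p.1 p.2) (Set.Ioo 0 1 ×ˢ Set.Icc y b)) :
    HasDerivAt (fun τ => ∫ s in y..b, (s - y) ^ (-τ) * u τ s)
      ((∫ s in y..b, (s - y) ^ (-σ₀) * uσ σ₀ s)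
        - ∫ s in y..b, Real.log (s - y) * (s - y) ^ (-σ₀) * u σ₀ s) σ₀ := by
  obtain ⟨c, hc0, hcσ⟩ := exists_between hσ₀.1
  obtain ⟨d, hσd, hd1⟩ := exists_between hσ₀.2
  have hsub : Set.Icc c d ⊆ Set.Ioo (0 : ℝ) 1 := fun τ hτ => ⟨hc0.trans_le hτ.1, hτ.2.trans_lt hd1⟩
  have hcompact : IsCompact (Set.Icc c d ×ˢ Set.Icc y b) := isCompact_Icc.prod isCompact_Icc
  obtain ⟨C₁, hC₁⟩ := hcompact.exists_bound_of_continuousOn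
    (hcont.mono (Set.prod_mono hsub subset_rfl))
  obtain ⟨C₂, hC₂⟩ := hcompact.exists_bound_of_continuousOn
    (hcontσ.mono (Set.prod_mono hsub subset_rfl))
  obtain ⟨K, ρ, hρ, hmaj⟩ := exists_majorant_rpow_log (hc0.trans (hcσ.trans hσd)) hd1
  have hslice : ∀ {f : ℝ → ℝ → ℝ},
      ContinuousOn (fun p : ℝ × ℝ => f p.1 p.2) (Set.Ioo 0 1 ×ˢ Set.Icc y b) →
      ∀ τ ∈ Set.Ioo (0 : ℝ) 1, ContinuousOn (f τ) (Set.Ioc y b) := fun hf τ hτ =>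
    hf.comp (by fun_prop : ContinuousOn (fun s : ℝ => (τ, s)) (Set.Ioc y b))
      fun s hs => ⟨hτ, Set.Ioc_subset_Icc_self hs⟩
  have hpow : ∀ τ : ℝ, ContinuousOn (fun s => (s - y) ^ (-τ)) (Set.Ioc y b) := fun τ =>
    ContinuousOn.rpow_const (by fun_prop) fun s hs => Or.inl (sub_pos.2 hs.1).ne'
  have hlog : ContinuousOn (fun s => Real.log (s - y)) (Set.Ioc y b) :=
    ContinuousOn.log (by fun_prop) fun s hs => (sub_pos.2 hs.1).ne'
  have hle : ∀ (f : ℝ → ℝ → ℝ) (C : ℝ),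
      (∀ p ∈ Set.Icc c d ×ˢ Set.Icc y b, ‖f p.1 p.2‖ ≤ C) →
      ∀ τ ∈ Set.Icc c d, ∀ s ∈ Set.Ioc y b,
        |(s - y) ^ (-τ) * f τ s| ≤ K * C * ((s - y) ^ ρ + (s - y)) ∧
        |Real.log (s - y) * (s - y) ^ (-τ) * f τ s| ≤ K * C * ((s - y) ^ ρ + (s - y)) := by
    intro f C hC τ hτ s hs
    have ht : 0 < s - y := sub_pos.2 hs.1
    obtain ⟨h1, h2⟩ := hmaj (s - y) ht τ (hc0.le.trans hτ.1) hτ.2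
    have h3 : |f τ s| ≤ C := hC (τ, s) ⟨hτ, Set.Ioc_subset_Icc_self hs⟩
    have hB : 0 ≤ K * ((s - y) ^ ρ + (s - y)) := (abs_nonneg _).trans h1
    rw [mul_right_comm K C, abs_mul, abs_mul _ (f τ s)]
    exact ⟨mul_le_mul h1 h3 (abs_nonneg _) hB, mul_le_mul h2 h3 (abs_nonneg _) hB⟩
  have hσ₀' : σ₀ ∈ Set.Icc c d := ⟨hcσ.le, hσd.le⟩
  have hint₁ := intervalIntegrable_of_continuousOn_of_le_rpow
    (f := fun s => (s - y) ^ (-σ₀) * uσ σ₀ s) hyb hρ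
    ((hpow σ₀).mul (hslice hcontσ σ₀ hσ₀)) fun s hs => (hle uσ C₂ hC₂ σ₀ hσ₀' s hs).1
  have hint₂ := intervalIntegrable_of_continuousOn_of_le_rpow
    (f := fun s => Real.log (s - y) * (s - y) ^ (-σ₀) * u σ₀ s) hyb hρ
    ((hlog.mul (hpow σ₀)).mul (hslice hcont σ₀ hσ₀))
    fun s hs => (hle u C₁ hC₁ σ₀ hσ₀' s hs).2
  have hint₀ := intervalIntegrable_of_continuousOn_of_le_rpow
    (f := fun s => (s - y) ^ (-σ₀) * u σ₀ s) hyb hρ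
    ((hpow σ₀).mul (hslice hcont σ₀ hσ₀)) fun s hs => (hle u C₁ hC₁ σ₀ hσ₀' s hs).1
  rw [← intervalIntegral.integral_sub hint₁ hint₂]
  refine (intervalIntegral.hasDerivAt_integral_of_dominated_loc_of_deriv_le
    (F' := fun τ s => (s - y) ^ (-τ) * uσ τ s - Real.log (s - y) * (s - y) ^ (-τ) * u τ s)
    (bound := fun s => (K * C₂ + K * C₁) * ((s - y) ^ ρ + (s - y)))
    (Icc_mem_nhds hcσ hσd) ?_ hint₀ ?_ ?_
    ((intervalIntegrable_rpow_sub_add hρ y b).const_mul _) ?_).2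
  · filter_upwards [Icc_mem_nhds hcσ hσd] with τ hτ
    rw [Set.uIoc_of_le hyb]
    exact ((hpow τ).mul (hslice hcont τ (hsub hτ))).aestronglyMeasurable measurableSet_Ioc
  · exact (hint₁.sub hint₂).aestronglyMeasurable_restrict_uIoc
  · refine .of_forall fun s hs τ hτ => ?_
    rw [Set.uIoc_of_le hyb] at hs
    rw [add_mul]
    exact (norm_sub_le _ _).trans
      (add_le_add (hle uσ C₂ hC₂ τ hτ s hs).1 (hle u C₁ hC₁ τ hτ s hs).2)
  · refine .of_forall fun s hs τ hτ => ?_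
    rw [Set.uIoc_of_le hyb] at hs
    have h := ((hasDerivAt_neg τ).const_rpow (sub_pos.2 hs.1)).mul
      (huσ τ (hsub hτ) s (Set.Ioc_subset_Icc_self hs))
    refine h.congr_deriv ?_
    ring


/-- equation (4.3) of the paper, case `n = 1`.
Sensitivity of the right-sided Riemann–Liouville fractional derivative with respect to
its order: with `J(σ,y) = ∫_y^b (s-y)^{-σ} u(σ,s) ds`, `Jx = ∂J/∂x`, `Jσ = ∂J/∂σ`
(valid on a neighborhood `V` of `(σ₀,x)`), commuting mixed second partials (common
value `M`), and with `D1`, `D2` the derivatives at `x` of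
`y ↦ ∫_y^b (s-y)^{-σ₀} (∂u/∂σ)(σ₀,s) ds` and
`y ↦ ∫_y^b log(s-y)(s-y)^{-σ₀} u(σ₀,s) ds`, the map
`σ ↦ (-1/Γ(1-σ)) Jx(σ,x)` is differentiable at `σ₀` with derivative
`(-1/Γ(1-σ₀)) D1 + A₁(σ₀)(-1/Γ(1-σ₀)) Jx(σ₀,x) - (-1/Γ(1-σ₀)) D2`, where
`A₁(σ) = Γ(1-σ) (d/dσ)(1/Γ(1-σ))`. -/
theorem stmt3 (a b : ℝ) (hab : a < b) (x : ℝ) (hx : x ∈ Set.Ico a b)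
    (u uσ : ℝ → ℝ → ℝ)
    (hcont : ContinuousOn (fun p : ℝ × ℝ => u p.1 p.2) (Set.Ioo 0 1 ×ˢ Set.Icc a b))
    (huσ : ∀ σ ∈ Set.Ioo (0:ℝ) 1, ∀ s ∈ Set.Icc a b,
      HasDerivAt (fun τ => u τ s) (uσ σ s) σ)
    (hcontσ : ContinuousOn (fun p : ℝ × ℝ => uσ p.1 p.2) (Set.Ioo 0 1 ×ˢ Set.Icc a b))
    (σ₀ : ℝ) (hσ₀ : σ₀ ∈ Set.Ioo (0:ℝ) 1)
    (Jx Jσ : ℝ → ℝ → ℝ)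
    (V : Set (ℝ × ℝ)) (hV : V ∈ nhds (σ₀, x))
    (hJx : ∀ p ∈ V,
      HasDerivAt (fun y => ∫ s in y..b, (s - y) ^ (-p.1) * u p.1 s) (Jx p.1 p.2) p.2)
    (hJσ : ∀ p ∈ V,
      HasDerivAt (fun τ => ∫ s in p.2..b, (s - p.2) ^ (-τ) * u τ s) (Jσ p.1 p.2) p.1)
    (M : ℝ)
    (hM1 : HasDerivAt (fun τ => Jx τ x) M σ₀)
    (hM2 : HasDerivAt (fun y => Jσ σ₀ y) M x)
    (D1 D2 : ℝ)
    (hD1 : HasDerivAt (fun y => ∫ s in y..b, (s - y) ^ (-σ₀) * uσ σ₀ s) D1 x)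
    (hD2 : HasDerivAt
      (fun y => ∫ s in y..b, Real.log (s - y) * (s - y) ^ (-σ₀) * u σ₀ s) D2 x) :
    HasDerivAt (fun σ => (-1 / Real.Gamma (1 - σ)) * Jx σ x)
      ((-1 / Real.Gamma (1 - σ₀)) * D1
        + (Real.Gamma (1 - σ₀) * deriv (fun τ => 1 / Real.Gamma (1 - τ)) σ₀)
            * ((-1 / Real.Gamma (1 - σ₀)) * Jx σ₀ x)
        - (-1 / Real.Gamma (1 - σ₀)) * D2) σ₀ := by
  have hgood : ∀ᶠ y in nhdsWithin x (Set.Ici x), Jσ σ₀ y =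
      (∫ s in y..b, (s - y) ^ (-σ₀) * uσ σ₀ s)
        - ∫ s in y..b, Real.log (s - y) * (s - y) ^ (-σ₀) * u σ₀ s := by
    have hVx : ∀ᶠ y in nhdsWithin x (Set.Ici x), (σ₀, y) ∈ V :=
      nhdsWithin_le_nhds ((by fun_prop : Continuous fun y : ℝ => (σ₀, y)).continuousAt hV)
    filter_upwards [hVx, Ico_mem_nhdsGE hx.2] with y hyV hy
    have hsub : Set.Icc y b ⊆ Set.Icc a b := Set.Icc_subset_Icc_left (hx.1.trans hy.1)
    exact (hJσ (σ₀, y) hyV).unique (hasDerivAt_integral_rpow_order hy.2.le hσ₀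
      (hcont.mono (Set.prod_mono subset_rfl hsub)) (fun σ hσ s hs => huσ σ hσ s (hsub hs))
      (hcontσ.mono (Set.prod_mono subset_rfl hsub)))
  have hM : M = D1 - D2 := (uniqueDiffWithinAt_Ici x).eq_deriv _ hM2.hasDerivWithinAt
    ((hD1.sub hD2).hasDerivWithinAt.congr_of_eventuallyEq_of_mem hgood Set.self_mem_Ici)
  have hpos : 0 < 1 - σ₀ := sub_pos.2 hσ₀.2
  have hΓ : Real.Gamma (1 - σ₀) ≠ 0 := (Real.Gamma_pos_of_pos hpos).ne'
  have hdiff : DifferentiableAt ℝ (fun τ => 1 / Real.Gamma (1 - τ)) σ₀ := by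
    have hG : DifferentiableAt ℝ Real.Gamma (1 - σ₀) := Real.differentiableAt_Gamma fun m hm => by
      have : (0 : ℝ) ≤ m := m.cast_nonneg
      linarith
    exact (differentiableAt_const _).div
      (hG.comp σ₀ (by fun_prop : DifferentiableAt ℝ (fun τ : ℝ => 1 - τ) σ₀)) hΓ
  have h := (hdiff.hasDerivAt.mul hM1).neg
  have hfun : (fun σ => (-1 / Real.Gamma (1 - σ)) * Jx σ x) =
      fun σ => -(1 / Real.Gamma (1 - σ) * Jx σ x) := by
    funext σ
    ring
  rw [hfun]
  refine h.congr_deriv ?_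
  rw [hM]
  field_simp
  ring
end

section
/- Let 0 < α < 1 and T > 0. Let u : [0,T] → ℝ be continuously differentiable with u(0) = 0, and let v : [0,T] → ℝ be continuously differentiable. Assume that for every t ∈ (0,T) the derivatives defining (D_{0+}^α u)(t), (D_{0+}^{α/2} u)(t) and (D_{T−}^{α/2} v)(t) exist, and that the functions t ↦ (D_{0+}^α u)(t)·v(t) and t ↦ (D_{0+}^{α/2} u)(t)·(D_{T−}^{α/2} v)(t) are integrable on (0,T). Then ∫_0^T (D_{0+}^α u)(t) · v(t) dt = ∫_0^T (D_{0+}^{α/2} u)(t) · (D_{T−}^{α/2} v)(t) dt. -/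
open MeasureTheory Set intervalIntegral

/-- The kernel `x ↦ x ^ (-γ)` cut off to `(0, c]`. -/
noncomputable def truncKernel (γ c : ℝ) : ℝ → ℝ := (Ioc 0 c).indicator fun x => x ^ (-γ)

lemma integrable_truncKernel {γ : ℝ} (hγ : γ < 1) {c : ℝ} (hc : 0 ≤ c) :
    Integrable (truncKernel γ c) := by
  rw [truncKernel, integrable_indicator_iff measurableSet_Ioc,
    ← intervalIntegrable_iff_integrableOn_Ioc_of_le hc]
  exact intervalIntegrable_rpow' (by linarith)

/-- Integrability of `p s * q t * (t - s) ^ (-γ)` over the triangle `a < s < t ≤ b`. -/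
def TriangleIntegrable (γ a b : ℝ) (p q : ℝ → ℝ) : Prop :=
  Integrable (fun z : ℝ × ℝ => p z.1 * (q z.2 * truncKernel γ (b - a) (z.2 - z.1)))
    ((volume.restrict (Ioc a b)).prod (volume.restrict (Ioc a b)))

lemma triangleIntegrable_of_continuousOn_left {a b γ : ℝ} (hab : a ≤ b) (hγ : γ < 1)
    {p q : ℝ → ℝ} (hp : ContinuousOn p (Icc a b)) (hq : IntervalIntegrable q volume a b) :
    TriangleIntegrable γ a b p q := by
  obtain ⟨C, hC⟩ := isCompact_Icc.exists_bound_of_continuousOn hp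
  have hp' : AEStronglyMeasurable p (volume.restrict (Ioc a b)) :=
    (hp.mono Ioc_subset_Icc_self).aestronglyMeasurable measurableSet_Ioc
  refine Integrable.bdd_mul (c := C) ?_ hp'.comp_fst ?_
  · have hq' : Integrable ((Ioc a b).indicator q) := by
      rw [integrable_indicator_iff measurableSet_Ioc,
        ← intervalIntegrable_iff_integrableOn_Ioc_of_le hab]
      exact hq
    have hk := (integrable_truncKernel hγ (sub_nonneg.2 hab)).comp_neg
    have := (hq'.convolution_integrand (ContinuousLinearMap.mul ℝ ℝ) hk).integrableOn
      (s := Ioc a b ×ˢ Ioc a b)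
    rw [Measure.prod_restrict]
    refine this.congr_fun (fun z hz => ?_) (measurableSet_Ioc.prod measurableSet_Ioc)
    simp [indicator_of_mem hz.2]
  · rw [Measure.prod_restrict]
    refine ae_restrict_of_forall_mem (measurableSet_Ioc.prod measurableSet_Ioc) fun z hz => ?_
    exact hC _ (Ioc_subset_Icc_self hz.1)

lemma triangleIntegrable_of_continuousOn_right {a b γ : ℝ} (hab : a ≤ b) (hγ : γ < 1)
    {p q : ℝ → ℝ} (hp : IntervalIntegrable p volume a b) (hq : ContinuousOn q (Icc a b)) :
    TriangleIntegrable γ a b p q := by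
  obtain ⟨C, hC⟩ := isCompact_Icc.exists_bound_of_continuousOn hq
  have hq' : AEStronglyMeasurable q (volume.restrict (Ioc a b)) :=
    (hq.mono Ioc_subset_Icc_self).aestronglyMeasurable measurableSet_Ioc
  simp_rw [TriangleIntegrable, mul_left_comm (p _)]
  refine Integrable.bdd_mul (c := C) ?_ hq'.comp_snd ?_
  · have hp' : Integrable ((Ioc a b).indicator p) := by
      rw [integrable_indicator_iff measurableSet_Ioc,
        ← intervalIntegrable_iff_integrableOn_Ioc_of_le hab]
      exact hp
    have hk := integrable_truncKernel hγ (sub_nonneg.2 hab)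
    have := (hp'.convolution_integrand (ContinuousLinearMap.mul ℝ ℝ) hk).swap.integrableOn
      (s := Ioc a b ×ˢ Ioc a b)
    rw [Measure.prod_restrict]
    refine this.congr_fun (fun z hz => ?_) (measurableSet_Ioc.prod measurableSet_Ioc)
    simp [indicator_of_mem hz.1]
  · rw [Measure.prod_restrict]
    refine ae_restrict_of_forall_mem (measurableSet_Ioc.prod measurableSet_Ioc) fun z hz => ?_
    exact hC _ (Ioc_subset_Icc_self hz.2)

lemma setIntegral_mul_truncKernel_right {a b s γ : ℝ} (hs : s ∈ Ioc a b) (q : ℝ → ℝ) :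
    ∫ t in Ioc a b, q t * truncKernel γ (b - a) (t - s) = ∫ t in s..b, (t - s) ^ (-γ) * q t := by
  have : Ioc s b = Ioc a b ∩ Ioi s := by
    ext x; simp only [mem_inter_iff, mem_Ioc, mem_Ioi]
    exact ⟨fun h => ⟨⟨hs.1.trans h.1, h.2⟩, h.1⟩, fun h => ⟨h.2, h.1.2⟩⟩
  rw [integral_of_le hs.2, this, ← setIntegral_indicator measurableSet_Ioi]
  refine setIntegral_congr_fun measurableSet_Ioc fun t ht => ?_
  by_cases h : s < t
  · have : t - s ∈ Ioc 0 (b - a) := ⟨by linarith, by linarith [ht.2, hs.1]⟩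
    simp [truncKernel, indicator_of_mem this, indicator_of_mem (mem_Ioi.2 h), mul_comm]
  · have : t - s ∉ Ioc 0 (b - a) := fun h' => h (by linarith [h'.1])
    simp [truncKernel, h]

lemma setIntegral_mul_truncKernel_left {a b t γ : ℝ} (ht : t ∈ Ioc a b) (p : ℝ → ℝ) :
    ∫ s in Ioc a b, p s * truncKernel γ (b - a) (t - s) = ∫ s in a..t, (t - s) ^ (-γ) * p s := by
  have : Ioo a t = Ioc a b ∩ Iio t := by
    ext x; simp only [mem_Ioo, mem_inter_iff, mem_Ioc, mem_Iio]
    exact ⟨fun h => ⟨⟨h.1, h.2.le.trans ht.2⟩, h.2⟩, fun h => ⟨h.1.1, h.2⟩⟩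
  rw [integral_of_le ht.1.le, integral_Ioc_eq_integral_Ioo (x := a) (y := t), this,
    ← setIntegral_indicator measurableSet_Iio]
  refine setIntegral_congr_fun measurableSet_Ioc fun s hs => ?_
  by_cases h : s < t
  · have : t - s ∈ Ioc 0 (b - a) := ⟨by linarith, by linarith [ht.2, hs.1]⟩
    simp [truncKernel, indicator_of_mem this, indicator_of_mem (mem_Iio.2 h), mul_comm]
  · have : t - s ∉ Ioc 0 (b - a) := fun h' => h (by linarith [h'.1])
    simp [truncKernel, h]

section Swap

variable {a b γ : ℝ} {p q : ℝ → ℝ}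

lemma intervalIntegrable_mul_integral_right (hab : a ≤ b)
    (h : TriangleIntegrable γ a b p q) :
    IntervalIntegrable (fun s => p s * ∫ t in s..b, (t - s) ^ (-γ) * q t) volume a b := by
  rw [intervalIntegrable_iff_integrableOn_Ioc_of_le hab]
  refine IntegrableOn.congr_fun (Integrable.integral_prod_left h) (fun s hs => ?_) measurableSet_Ioc
  simp only [MeasureTheory.integral_const_mul]
  rw [setIntegral_mul_truncKernel_right hs]

lemma intervalIntegrable_mul_integral_left (hab : a ≤ b)
    (h : TriangleIntegrable γ a b p q) :
    IntervalIntegrable (fun t => q t * ∫ s in a..t, (t - s) ^ (-γ) * p s) volume a b := by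
  rw [intervalIntegrable_iff_integrableOn_Ioc_of_le hab]
  refine IntegrableOn.congr_fun (Integrable.integral_prod_right h) (fun t ht => ?_) measurableSet_Ioc
  simp only [mul_left_comm (p _), MeasureTheory.integral_const_mul]
  rw [setIntegral_mul_truncKernel_left ht]

lemma integral_mul_integral_swap (hab : a ≤ b)
    (h : TriangleIntegrable γ a b p q) :
    ∫ s in a..b, p s * ∫ t in s..b, (t - s) ^ (-γ) * q t =
      ∫ t in a..b, q t * ∫ s in a..t, (t - s) ^ (-γ) * p s := by
  have := integral_integral_swap
    (f := fun s t => p s * (q t * truncKernel γ (b - a) (t - s))) h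
  rw [integral_of_le hab, integral_of_le hab]
  convert this using 1
  · refine setIntegral_congr_fun measurableSet_Ioc fun s hs => ?_
    simp only [MeasureTheory.integral_const_mul]
    rw [setIntegral_mul_truncKernel_right hs]
  · refine setIntegral_congr_fun measurableSet_Ioc fun t ht => ?_
    simp only [mul_left_comm (p _), MeasureTheory.integral_const_mul]
    rw [setIntegral_mul_truncKernel_left ht]

end Swap

lemma integral_sub_left_rpow_neg {a b γ : ℝ} (hγ : γ < 1) :
    ∫ s in a..b, (b - s) ^ (-γ) = (b - a) ^ (1 - γ) / (1 - γ) := by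
  rw [integral_comp_sub_left (fun x => x ^ (-γ)), integral_rpow (by left; linarith), sub_self,
    Real.zero_rpow (by linarith), sub_zero, neg_add_eq_sub]

lemma integral_sub_right_rpow_neg {a b γ : ℝ} (hγ : γ < 1) :
    ∫ t in a..b, (t - a) ^ (-γ) = (b - a) ^ (1 - γ) / (1 - γ) := by
  rw [integral_comp_sub_right (fun x => x ^ (-γ)), integral_rpow (by left; linarith), sub_self,
    Real.zero_rpow (by linarith), sub_zero, neg_add_eq_sub]

lemma intervalIntegrable_sub_left_rpow_neg {a b c γ : ℝ} (hγ : γ < 1) :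
    IntervalIntegrable (fun s => (c - s) ^ (-γ)) volume a b := by
  have := (intervalIntegrable_rpow' (a := c - a) (b := c - b) (r := -γ)
    (by linarith)).comp_sub_left c
  simpa using this

lemma intervalIntegrable_sub_right_rpow_neg {a b c γ : ℝ} (hγ : γ < 1) :
    IntervalIntegrable (fun s => (s - c) ^ (-γ)) volume a b := by
  have := (intervalIntegrable_rpow' (a := a - c) (b := b - c) (r := -γ)
    (by linarith)).comp_sub_right c
  simpa using this

lemma integral_sub_rpow_mul_sub_rpow {a b γ δ : ℝ} (hab : a < b) (hγ : γ < 1) (hδ : δ < 1) :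
    ∫ t in a..b, (b - t) ^ (-γ) * (t - a) ^ (-δ) =
      Real.Gamma (1 - δ) * Real.Gamma (1 - γ) / Real.Gamma (2 - δ - γ) *
        (b - a) ^ (1 - δ - γ) := by
  have hc : 0 < b - a := sub_pos.2 hab
  have h1 : ∫ t in a..b, (b - t) ^ (-γ) * (t - a) ^ (-δ) =
      ∫ x in 0..(b - a), x ^ (-δ) * (b - a - x) ^ (-γ) := by
    have := integral_comp_sub_right (a := a) (b := b)
      (fun x => x ^ (-δ) * (b - a - x) ^ (-γ)) a
    rw [sub_self] at this
    rw [← this]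
    refine integral_congr fun t _ => ?_
    simp [mul_comm]
  have h2 := Complex.betaIntegral_scaled (((1 - δ : ℝ)) : ℂ) ((1 - γ : ℝ) : ℂ) hc
  rw [Complex.betaIntegral_eq_Gamma_mul_div _ _ (by simpa using hδ) (by simpa using hγ)] at h2
  rw [h1, ← Complex.ofReal_inj]
  have h3 : ((∫ x in 0..(b - a), x ^ (-δ) * (b - a - x) ^ (-γ) : ℝ) : ℂ) =
      ∫ x in 0..(b - a), (x : ℂ) ^ (((1 - δ : ℝ) : ℂ) - 1) *
        (((b - a : ℝ) : ℂ) - x) ^ (((1 - γ : ℝ) : ℂ) - 1) := by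
    rw [← intervalIntegral.integral_ofReal]
    refine integral_congr fun x hx => ?_
    rw [uIcc_of_le hc.le] at hx
    simp only [Complex.ofReal_mul]
    rw [Complex.ofReal_cpow hx.1, Complex.ofReal_cpow (by linarith [hx.2])]
    push_cast
    ring_nf
  rw [h3, h2]
  have h4 : ((1 - δ : ℝ) : ℂ) + ((1 - γ : ℝ) : ℂ) - 1 = ((1 - δ - γ : ℝ) : ℂ) := by
    push_cast; ring
  have h5 : ((1 - δ : ℝ) : ℂ) + ((1 - γ : ℝ) : ℂ) = ((2 - δ - γ : ℝ) : ℂ) := by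
    push_cast; ring
  rw [h4, h5, Complex.Gamma_ofReal, Complex.Gamma_ofReal, Complex.Gamma_ofReal,
    ← Complex.ofReal_cpow hc.le]
  push_cast
  ring

lemma integral_derivWithin_Icc {a b c d : ℝ} {f : ℝ → ℝ} (hab : a < b)
    (hf : ContDiffOn ℝ 1 f (Icc a b)) (hac : a ≤ c) (hcd : c ≤ d) (hdb : d ≤ b) :
    ∫ x in c..d, derivWithin f (Icc a b) x = f d - f c := by
  have hsub : Icc c d ⊆ Icc a b := Icc_subset_Icc hac hdb
  refine integral_eq_sub_of_hasDerivAt_of_le hcd (hf.continuousOn.mono hsub) (fun x hx => ?_) ?_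
  · have hx' : x ∈ Ioo a b := ⟨hac.trans_lt hx.1, hx.2.trans_le hdb⟩
    exact ((hf.differentiableOn one_ne_zero) x (Ioo_subset_Icc_self hx')).hasDerivWithinAt.hasDerivAt
      (Icc_mem_nhds hx'.1 hx'.2)
  · refine ContinuousOn.intervalIntegrable_of_Icc hcd (ContinuousOn.mono ?_ hsub)
    exact hf.continuousOn_derivWithin (uniqueDiffOn_Icc hab) le_rfl

section LeftSided

variable {a b γ : ℝ} {f : ℝ → ℝ}

lemma intervalIntegrable_leftIntegral (hab : a ≤ b) (hγ : γ < 1)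
    (hf : ContinuousOn f (Icc a b)) :
    IntervalIntegrable (fun t => ∫ s in a..t, (t - s) ^ (-γ) * f s) volume a b := by
  simpa using intervalIntegrable_mul_integral_left hab
    (triangleIntegrable_of_continuousOn_left (q := fun _ => 1) hab hγ hf
      intervalIntegrable_const)

lemma integral_leftIntegral (hab : a ≤ b) (hγ : γ < 1) (hf : ContinuousOn f (Icc a b)) :
    ∫ t in a..b, ∫ s in a..t, (t - s) ^ (-γ) * f s =
      ∫ s in a..b, (b - s) ^ (-γ) * ∫ r in a..s, f r := by
  have h1 := integral_mul_integral_swap hab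
    (triangleIntegrable_of_continuousOn_left (q := fun _ => 1) hab hγ hf
      intervalIntegrable_const)
  have h2 := integral_mul_integral_swap hab
    (triangleIntegrable_of_continuousOn_left hab zero_lt_one hf
      (intervalIntegrable_sub_left_rpow_neg (c := b) hγ))
  simp only [mul_one, one_mul, integral_sub_right_rpow_neg hγ] at h1
  simp only [neg_zero, Real.rpow_zero, one_mul, integral_sub_left_rpow_neg hγ] at h2
  rw [← h1, ← h2]

end LeftSided

/-- For `v s = c - ∫ r in s..b, h r`, the derivative of
`y ↦ -∫ s in y..b, (s - y) ^ (-γ) * v s` in explicit form. -/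
noncomputable def rightDerivFormula (γ b c : ℝ) (h : ℝ → ℝ) (t : ℝ) : ℝ :=
  c * (b - t) ^ (-γ) - ∫ r in t..b, (r - t) ^ (-γ) * h r

section RightSided

variable {a b γ δ c : ℝ} {h v : ℝ → ℝ}

lemma intervalIntegrable_rightIntegral (hab : a ≤ b) (hγ : γ < 1)
    (hh : ContinuousOn h (Icc a b)) :
    IntervalIntegrable (fun t => ∫ s in t..b, (s - t) ^ (-γ) * h s) volume a b := by
  simpa using intervalIntegrable_mul_integral_right hab
    (triangleIntegrable_of_continuousOn_right (p := fun _ => 1) hab hγ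
      intervalIntegrable_const hh)

lemma intervalIntegrable_rightDerivFormula (hab : a ≤ b) (hγ : γ < 1)
    (hh : ContinuousOn h (Icc a b)) :
    IntervalIntegrable (rightDerivFormula γ b c h) volume a b :=
  ((intervalIntegrable_sub_left_rpow_neg hγ).const_mul c).sub
    (intervalIntegrable_rightIntegral hab hγ hh)

lemma integral_sub_rpow_mul_of_eq (hab : a ≤ b) (hγ : γ < 1) (hh : ContinuousOn h (Icc a b))
    (hv : ∀ s ∈ Icc a b, v s = c - ∫ r in s..b, h r) :
    ∫ s in a..b, (s - a) ^ (-γ) * v s =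
      (c * (b - a) ^ (1 - γ) - ∫ r in a..b, h r * (r - a) ^ (1 - γ)) / (1 - γ) := by
  have hI := triangleIntegrable_of_continuousOn_right hab zero_lt_one
    (intervalIntegrable_sub_right_rpow_neg (c := a) hγ) hh
  have h1 := integral_mul_integral_swap hab hI
  have h2 := intervalIntegrable_mul_integral_right hab hI
  simp only [neg_zero, Real.rpow_zero, one_mul, integral_sub_right_rpow_neg hγ] at h1 h2
  calc ∫ s in a..b, (s - a) ^ (-γ) * v s
      = ∫ s in a..b, ((s - a) ^ (-γ) * c - (s - a) ^ (-γ) * ∫ r in s..b, h r) := by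
        refine integral_congr fun s hs => ?_
        rw [uIcc_of_le hab] at hs
        simp only [hv s hs, mul_sub]
    _ = _ := by
        rw [integral_sub ((intervalIntegrable_sub_right_rpow_neg hγ).mul_const c) h2, h1,
          intervalIntegral.integral_mul_const, integral_sub_right_rpow_neg hγ]
        simp only [← mul_div_assoc, intervalIntegral.integral_div]
        ring

lemma integral_rightDerivFormula (hab : a ≤ b) (hγ : γ < 1) (hh : ContinuousOn h (Icc a b)) :
    ∫ t in a..b, rightDerivFormula γ b c h t =
      (c * (b - a) ^ (1 - γ) - ∫ r in a..b, h r * (r - a) ^ (1 - γ)) / (1 - γ) := by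
  have h1 := integral_mul_integral_swap hab
    (triangleIntegrable_of_continuousOn_right (p := fun _ => 1) hab hγ
      intervalIntegrable_const hh)
  simp only [mul_one, one_mul, integral_sub_left_rpow_neg hγ] at h1
  simp only [rightDerivFormula]
  rw [integral_sub ((intervalIntegrable_sub_left_rpow_neg hγ).const_mul c)
    (intervalIntegrable_rightIntegral hab hγ hh), h1, intervalIntegral.integral_const_mul,
    integral_sub_left_rpow_neg hγ]
  simp only [← mul_div_assoc, intervalIntegral.integral_div]
  ring

lemma integral_sub_rpow_mul_rightDerivFormula (hab : a < b) (hγ : γ < 1) (hδ : δ < 1)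
    (hh : ContinuousOn h (Icc a b)) :
    ∫ t in a..b, (t - a) ^ (-δ) * rightDerivFormula γ b c h t =
      Real.Gamma (1 - δ) * Real.Gamma (1 - γ) / Real.Gamma (2 - δ - γ) *
      (c * (b - a) ^ (1 - δ - γ) - ∫ r in a..b, h r * (r - a) ^ (1 - δ - γ)) := by
  have hI := triangleIntegrable_of_continuousOn_right hab.le hγ
    (intervalIntegrable_sub_right_rpow_neg (c := a) hδ) hh
  have h1 := integral_mul_integral_swap hab.le hI
  have h2 := intervalIntegrable_mul_integral_right hab.le hI
  have h3 : IntervalIntegrable (fun t => (b - t) ^ (-γ) * (t - a) ^ (-δ)) volume a b := by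
    have h4 := integral_sub_rpow_mul_sub_rpow hab hγ hδ
    refine by_contra fun h5 => ?_
    rw [integral_undef h5] at h4
    have := Real.Gamma_pos_of_pos (sub_pos.2 hγ)
    have := Real.Gamma_pos_of_pos (sub_pos.2 hδ)
    have := Real.Gamma_pos_of_pos (show 0 < 2 - δ - γ by linarith)
    have := sub_pos.2 hab
    exact absurd h4 (by positivity)
  have h6 : ∫ t in a..b, h t * ∫ s in a..t, (t - s) ^ (-γ) * (s - a) ^ (-δ) =
      ∫ t in a..b, Real.Gamma (1 - δ) * Real.Gamma (1 - γ) / Real.Gamma (2 - δ - γ) *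
        (h t * (t - a) ^ (1 - δ - γ)) := by
    rw [integral_of_le hab.le, integral_of_le hab.le]
    refine setIntegral_congr_fun measurableSet_Ioc fun t ht => ?_
    simp only [integral_sub_rpow_mul_sub_rpow ht.1 hγ hδ]
    ring
  calc ∫ t in a..b, (t - a) ^ (-δ) * rightDerivFormula γ b c h t
      = ∫ t in a..b, (c * ((b - t) ^ (-γ) * (t - a) ^ (-δ)) -
          (t - a) ^ (-δ) * ∫ r in t..b, (r - t) ^ (-γ) * h r) := by
        refine integral_congr fun t _ => ?_
        simp only [rightDerivFormula]
        ring
    _ = _ := by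
        rw [integral_sub (h3.const_mul c) h2, h1, h6, intervalIntegral.integral_const_mul,
          intervalIntegral.integral_const_mul, integral_sub_rpow_mul_sub_rpow hab hγ hδ]
        ring

end RightSided

lemma ae_eq_of_hasDerivAt_of_eqOn_integral {a b : ℝ} {F G P : ℝ → ℝ} (hab : a ≤ b)
    (hF : ∀ t ∈ Ioo a b, HasDerivAt F (G t) t) (hP : IntervalIntegrable P volume a b)
    (hFP : ∀ y ∈ Ioo a b, F y = ∫ t in a..y, P t) :
    ∀ᵐ t, t ∈ Ioo a b → G t = P t := by
  filter_upwards [hP.ae_hasDerivAt_integral] with t ht hmem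
  rw [uIcc_of_le hab] at ht
  refine (hF t hmem).unique ?_
  refine (ht (Ioo_subset_Icc_self hmem) a (left_mem_Icc.2 hab)).congr_of_eventuallyEq ?_
  filter_upwards [Ioo_mem_nhds hmem.1 hmem.2] with y hy using hFP y hy

lemma ae_eq_neg_of_hasDerivAt_of_eqOn_integral {a b : ℝ} {F G P : ℝ → ℝ} (hab : a ≤ b)
    (hF : ∀ t ∈ Ioo a b, HasDerivAt F (G t) t) (hP : IntervalIntegrable P volume a b)
    (hFP : ∀ y ∈ Ioo a b, F y = ∫ t in y..b, P t) :
    ∀ᵐ t, t ∈ Ioo a b → G t = -P t := by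
  filter_upwards [hP.ae_hasDerivAt_integral] with t ht hmem
  rw [uIcc_of_le hab] at ht
  refine (hF t hmem).unique ?_
  refine (ht (Ioo_subset_Icc_self hmem) b (right_mem_Icc.2 hab)).neg.congr_of_eventuallyEq ?_
  filter_upwards [Ioo_mem_nhds hmem.1 hmem.2] with y hy
  rw [hFP y hy, integral_symm]
  rfl

lemma ae_eq_leftIntegral_derivWithin {T γ : ℝ} (hT : 0 < T) (hγ : γ < 1) {u G : ℝ → ℝ}
    (hu : ContDiffOn ℝ 1 u (Icc 0 T)) (hu0 : u 0 = 0)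
    (hG : ∀ t ∈ Ioo 0 T, HasDerivAt (fun y => ∫ s in 0..y, (y - s) ^ (-γ) * u s) (G t) t) :
    ∀ᵐ t, t ∈ Ioo 0 T →
      G t = ∫ s in 0..t, (t - s) ^ (-γ) * derivWithin u (Icc 0 T) s := by
  have hu' := hu.continuousOn_derivWithin (uniqueDiffOn_Icc hT) le_rfl
  refine ae_eq_of_hasDerivAt_of_eqOn_integral hT.le hG
    (intervalIntegrable_leftIntegral hT.le hγ hu') fun y hy => ?_
  rw [integral_leftIntegral hy.1.le hγ (hu'.mono (Icc_subset_Icc le_rfl hy.2.le))]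
  refine integral_congr fun s hs => ?_
  rw [uIcc_of_le hy.1.le] at hs
  simp only [integral_derivWithin_Icc hT hu le_rfl hs.1 (hs.2.trans hy.2.le), hu0, sub_zero]


/-- Lemma 2.4 of the paper.
Fractional integration by parts in time: for `0 < α < 1`, `u` continuously
differentiable on `[0,T]` with `u(0) = 0`, `v` continuously differentiable on `[0,T]`,
with `g`, `g2`, `g3` the derivatives defining the Riemann–Liouville derivatives
`D_{0+}^α u = (1/Γ(1-α)) g`, `D_{0+}^{α/2} u = (1/Γ(1-α/2)) g2`, and
`D_{T-}^{α/2} v = (-1/Γ(1-α/2)) g3` on `(0,T)`, and assuming integrability of the two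
products, one has
`∫_0^T (D_{0+}^α u) v = ∫_0^T (D_{0+}^{α/2} u)(D_{T-}^{α/2} v)`. -/
theorem stmt8 (α T : ℝ) (hα0 : 0 < α) (hα1 : α < 1) (hT : 0 < T)
    (u v : ℝ → ℝ)
    (hu : ContDiffOn ℝ 1 u (Set.Icc 0 T)) (hu0 : u 0 = 0)
    (hv : ContDiffOn ℝ 1 v (Set.Icc 0 T))
    (g g2 g3 : ℝ → ℝ)
    (hg : ∀ t ∈ Set.Ioo (0:ℝ) T,
      HasDerivAt (fun y => ∫ s in (0:ℝ)..y, (y - s) ^ (-α) * u s) (g t) t)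
    (hg2 : ∀ t ∈ Set.Ioo (0:ℝ) T,
      HasDerivAt (fun y => ∫ s in (0:ℝ)..y, (y - s) ^ (-(α/2)) * u s) (g2 t) t)
    (hg3 : ∀ t ∈ Set.Ioo (0:ℝ) T,
      HasDerivAt (fun y => ∫ s in y..T, (s - y) ^ (-(α/2)) * v s) (g3 t) t)
    (hint1 : IntervalIntegrable (fun t => (1 / Real.Gamma (1 - α)) * g t * v t)
      MeasureTheory.volume 0 T)
    (hint2 : IntervalIntegrable (fun t =>
        ((1 / Real.Gamma (1 - α/2)) * g2 t) * ((-1 / Real.Gamma (1 - α/2)) * g3 t))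
      MeasureTheory.volume 0 T) :
    ∫ t in (0:ℝ)..T, (1 / Real.Gamma (1 - α)) * g t * v t
      = ∫ t in (0:ℝ)..T,
          ((1 / Real.Gamma (1 - α/2)) * g2 t) * ((-1 / Real.Gamma (1 - α/2)) * g3 t) := by
  have hβ : α / 2 < 1 := by linarith
  set f := derivWithin u (Icc 0 T)
  set h := derivWithin v (Icc 0 T) with h_def
  have hf : ContinuousOn f (Icc 0 T) :=
    hu.continuousOn_derivWithin (uniqueDiffOn_Icc hT) le_rfl
  have hh : ContinuousOn h (Icc 0 T) :=
    hv.continuousOn_derivWithin (uniqueDiffOn_Icc hT) le_rfl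
  have hv_eq : ∀ s ∈ Icc 0 T, v s = v T - ∫ r in s..T, h r := fun s hs => by
    rw [h_def, integral_derivWithin_Icc hT hv hs.1 hs.2 le_rfl]; ring
  have hh_sub : ∀ {y : ℝ}, 0 ≤ y → ContinuousOn h (Icc y T) := fun hy =>
    hh.mono (Icc_subset_Icc hy le_rfl)
  have hv_sub : ∀ {y : ℝ}, 0 ≤ y → ∀ s ∈ Icc y T, v s = v T - ∫ r in s..T, h r :=
    fun hy s hs => hv_eq s ⟨hy.trans hs.1, hs.2⟩
  set R := rightDerivFormula (α / 2) T (v T) h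
  have hR : IntervalIntegrable R volume 0 T :=
    intervalIntegrable_rightDerivFormula hT.le hβ hh
  have hg_ae : ∀ᵐ t, t ∈ Ioo 0 T → g t = ∫ s in 0..t, (t - s) ^ (-α) * f s :=
    ae_eq_leftIntegral_derivWithin hT hα1 hu hu0 hg
  have hg2_ae : ∀ᵐ t, t ∈ Ioo 0 T → g2 t = ∫ s in 0..t, (t - s) ^ (-(α / 2)) * f s :=
    ae_eq_leftIntegral_derivWithin hT hβ hu hu0 hg2
  have hg3_ae : ∀ᵐ t, t ∈ Ioo 0 T → g3 t = -R t := by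
    refine ae_eq_neg_of_hasDerivAt_of_eqOn_integral hT.le hg3 hR fun y hy => ?_
    rw [integral_sub_rpow_mul_of_eq hy.2.le hβ (hh_sub hy.1.le) (hv_sub hy.1.le),
      integral_rightDerivFormula hy.2.le hβ (hh_sub hy.1.le)]
  have hT_ae : ∀ᵐ t : ℝ, t ≠ T := by simp [ae_iff]
  have hΓα : Real.Gamma (1 - α) ≠ 0 := (Real.Gamma_pos_of_pos (by linarith)).ne'
  have hΓβ : Real.Gamma (1 - α / 2) ≠ 0 := (Real.Gamma_pos_of_pos (by linarith)).ne'
  have hΓ : Real.Gamma (2 - α) = (1 - α) * Real.Gamma (1 - α) := by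
    rw [← Real.Gamma_add_one (by linarith)]; congr 1; ring
  have hα : 1 - α ≠ 0 := by linarith
  calc ∫ t in (0:ℝ)..T, (1 / Real.Gamma (1 - α)) * g t * v t
      = ∫ t in (0:ℝ)..T, (1 / Real.Gamma (1 - α)) *
          (v t * ∫ s in 0..t, (t - s) ^ (-α) * f s) := by
        refine integral_congr_ae ?_
        filter_upwards [hg_ae, hT_ae] with t ht htT hmem
        rw [uIoc_of_le hT.le] at hmem
        rw [ht ⟨hmem.1, hmem.2.lt_of_ne htT⟩]
        ring
    _ = (1 / Real.Gamma (1 - α)) *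
          ∫ s in (0:ℝ)..T, f s * ∫ t in s..T, (t - s) ^ (-α) * v t := by
        rw [intervalIntegral.integral_const_mul, integral_mul_integral_swap hT.le
          (triangleIntegrable_of_continuousOn_left hT.le hα1 hf
            (hv.continuousOn.intervalIntegrable_of_Icc hT.le))]
    _ = (1 / Real.Gamma (1 - α / 2) ^ 2) *
          ∫ s in (0:ℝ)..T, f s * ∫ t in s..T, (t - s) ^ (-(α / 2)) * R t := by
        rw [← intervalIntegral.integral_const_mul, ← intervalIntegral.integral_const_mul]
        refine integral_congr_ae ?_
        filter_upwards [hT_ae] with s hsT hmem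
        rw [uIoc_of_le hT.le] at hmem
        rw [integral_sub_rpow_mul_of_eq hmem.2 hα1 (hh_sub hmem.1.le) (hv_sub hmem.1.le),
          integral_sub_rpow_mul_rightDerivFormula (hmem.2.lt_of_ne hsT) hβ hβ (hh_sub hmem.1.le),
          show 1 - α / 2 - α / 2 = 1 - α by ring, show 2 - α / 2 - α / 2 = 2 - α by ring, hΓ]
        generalize Real.Gamma (1 - α / 2) = G at hΓβ
        field_simp
    _ = ∫ t in (0:ℝ)..T, (1 / Real.Gamma (1 - α / 2) ^ 2) *
          (R t * ∫ s in 0..t, (t - s) ^ (-(α / 2)) * f s) := by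
        rw [intervalIntegral.integral_const_mul, integral_mul_integral_swap hT.le
          (triangleIntegrable_of_continuousOn_left hT.le hβ hf hR)]
    _ = _ := by
        refine integral_congr_ae ?_
        filter_upwards [hg2_ae, hg3_ae, hT_ae] with t ht2 ht3 htT hmem
        rw [uIoc_of_le hT.le] at hmem
        rw [ht2 ⟨hmem.1, hmem.2.lt_of_ne htT⟩, ht3 ⟨hmem.1, hmem.2.lt_of_ne htT⟩]
        ring
end
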